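/- Let d, m ≥ 1, let (Ω,μ) be a σ-finite measure space, let r⃗ ∈ (0,∞)^m, s ∈ (1,∞], and t⃗ ∈ (0,∞]^m with t_j > r_j for all j and 1 ≤ t < s, where 1/t := ∑_{j=1}^m 1/t_j, and let t' denote the Hölder conjugate of t. Then for all p⃗ ∈ (0,∞]^m with p_j > r_j for all j and all p_{m+1} ∈ (s',∞], setting 1/ρ := ∑_{j=1}^m 1/p_j + 1/p_{m+1} and assuming ρ < ∞, there is a constant C depending only on d, m, p⃗, p_{m+1}, r⃗, s, t⃗ such that for every finite collection 𝒟 of cubes and all jointly measurable f_j : ℝ^d × Ω → ℂ (1 ≤ j ≤ m) and g : ℝ^d × Ω → ℂ: ‖ ‖M̃^𝒟_{(r_1,…,r_m,s')}(f_1,…,f_m,g)(x,·)‖_{L^1(Ω)} ‖_{L^ρ(ℝ^d,dx)} ≤ C · (∏_{j=1}^m ‖ ‖f_j(x,·)‖_{L^{t_j}(Ω)} ‖_{L^{p_j}(ℝ^d,dx)}) · ‖ ‖g(x,·)‖_{L^{t'}(Ω)} ‖_{L^{p_{m+1}}(ℝ^d,dx)}. -/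

import Mathlib

open MeasureTheory ENNReal

noncomputable section

structure Cube (d : ℕ) where
  corner : Fin d → ℝ
  side : ℝ
  side_pos : 0 < side

namespace Cube
def set {d : ℕ} (Q : Cube d) : Set (Fin d → ℝ) :=
  {x | ∀ i, Q.corner i ≤ x i ∧ x i < Q.corner i + Q.side}
def vol {d : ℕ} (Q : Cube d) : ℝ≥0∞ := volume Q.set
def IsDyadic {d : ℕ} (Q : Cube d) : Prop :=
  ∃ (k : ℤ) (n : Fin d → ℤ), Q.side = (2:ℝ) ^ (-k) ∧ ∀ i, Q.corner i = (2:ℝ) ^ (-k) * (n i : ℝ)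
end Cube

def IsSparse {d : ℕ} (S : Set (Cube d)) : Prop :=
  ∃ E : Cube d → Set (Fin d → ℝ),
    (∀ Q ∈ S, MeasurableSet (E Q) ∧ E Q ⊆ Q.set ∧ Q.vol ≤ 2 * volume (E Q)) ∧
    S.PairwiseDisjoint E

def eNorm {α : Type*} [MeasurableSpace α] (p : ℝ≥0∞) (μ : Measure α) (F : α → ℝ≥0∞) : ℝ≥0∞ :=
  if p = ∞ then essSup F μ else (∫⁻ x, F x ^ p.toReal ∂μ) ^ (1 / p.toReal)

def nn {α : Type*} (f : α → ℂ) : α → ℝ≥0∞ := fun x => (‖f x‖₊ : ℝ≥0∞)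

def avg {d : ℕ} (r : ℝ≥0∞) (F : (Fin d → ℝ) → ℝ≥0∞) (Q : Cube d) : ℝ≥0∞ :=
  if r = ∞ then essSup F (volume.restrict Q.set)
  else ((∫⁻ x in Q.set, F x ^ r.toReal) / Q.vol) ^ (1 / r.toReal)

def maximal {d k : ℕ} (r : Fin k → ℝ≥0∞) (F : Fin k → (Fin d → ℝ) → ℝ≥0∞)
    (x : Fin d → ℝ) : ℝ≥0∞ :=
  ⨆ (Q : Cube d) (_ : x ∈ Q.set), ∏ j, avg (r j) (F j) Q

def maximalX {d k : ℕ} (r : Fin k → ℝ≥0∞) (ρ : ℝ≥0∞) (F : Fin k → (Fin d → ℝ) → ℝ≥0∞)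
    (G : (Fin d → ℝ) → ℝ≥0∞) (x : Fin d → ℝ) : ℝ≥0∞ :=
  ⨆ (Q : Cube d) (_ : x ∈ Q.set), (∏ j, avg (r j) (F j) Q) * avg ρ G Q

def wNorm {d : ℕ} (p : ℝ≥0∞) (w : (Fin d → ℝ) → ℝ) (F : (Fin d → ℝ) → ℝ≥0∞) : ℝ≥0∞ :=
  eNorm p volume (fun x => F x * ENNReal.ofReal (w x))

def aConst {d m : ℕ} (p r : Fin m → ℝ≥0∞) (s : ℝ≥0∞)
    (w : Fin m → (Fin d → ℝ) → ℝ) : ℝ≥0∞ :=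
  ⨆ Q : Cube d,
    (∏ j, avg ((r j)⁻¹ - (p j)⁻¹)⁻¹ (fun x => ENNReal.ofReal (w j x)⁻¹) Q) *
      avg ((∑ j, (p j)⁻¹) - s⁻¹)⁻¹ (fun x => ENNReal.ofReal (∏ j, w j x)) Q

def latAvg {d : ℕ} {Ω : Type*} (r : ℝ≥0∞) (f : (Fin d → ℝ) → Ω → ℂ) (Q : Cube d) (ω : Ω) : ℝ≥0∞ :=
  ((∫⁻ y in Q.set, (‖f y ω‖₊ : ℝ≥0∞) ^ r.toReal) / Q.vol) ^ (1 / r.toReal)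

def latMax {d m : ℕ} {Ω : Type*} (r : Fin m → ℝ≥0∞) (D : Finset (Cube d))
    (f : Fin m → (Fin d → ℝ) → Ω → ℂ) (x : Fin d → ℝ) (ω : Ω) : ℝ≥0∞ :=
  ⨆ Q ∈ D, ⨆ (_ : x ∈ Cube.set Q), ∏ j, latAvg (r j) (f j) Q ω

def latMaxX {d m : ℕ} {Ω : Type*} (r : Fin m → ℝ≥0∞) (ρ : ℝ≥0∞) (D : Finset (Cube d))
    (f : Fin m → (Fin d → ℝ) → Ω → ℂ) (g : (Fin d → ℝ) → Ω → ℂ)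
    (x : Fin d → ℝ) (ω : Ω) : ℝ≥0∞ :=
  ⨆ Q ∈ D, ⨆ (_ : x ∈ Cube.set Q), (∏ j, latAvg (r j) (f j) Q ω) * latAvg ρ g Q ω

def MemLinftyC {d : ℕ} (f : (Fin d → ℝ) → ℂ) : Prop :=
  Measurable f ∧ (∃ M : ℝ, ∀ x, ‖f x‖ ≤ M) ∧ Bornology.IsBounded (Function.support f)

def SimpleLinftyC {d : ℕ} (f : (Fin d → ℝ) → ℂ) : Prop :=
  Measurable f ∧ (Set.range f).Finite ∧ Bornology.IsBounded (Function.support f)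

def PairSimple {d : ℕ} {Ω : Type*} [MeasurableSpace Ω] (f : (Fin d → ℝ) → Ω → ℂ) : Prop :=
  Measurable (Function.uncurry f) ∧ (Set.range (Function.uncurry f)).Finite ∧
    ∃ B : Set (Fin d → ℝ), Bornology.IsBounded B ∧ ∀ x ∉ B, ∀ ω, f x ω = 0

def VecSimple {d : ℕ} {Ω : Type*} [MeasurableSpace Ω] (f : (Fin d → ℝ) → Ω → ℂ) : Prop :=
  ∃ (N : ℕ) (A : Fin N → Set (Fin d → ℝ)) (ξ : Fin N → Ω → ℂ),
    (∀ i, MeasurableSet (A i)) ∧ (∀ i, Bornology.IsBounded (A i)) ∧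
    (∀ i, Measurable (ξ i)) ∧ (∃ M : ℝ, ∀ i ω, ‖ξ i ω‖ ≤ M) ∧
    ∀ x ω, f x ω = ∑ i, (A i).indicator (fun _ => ξ i ω) x



/-- The uncentred maximal operator with respect to a measure. -/
def mxOp {d : ℕ} (ν : Measure (Fin d → ℝ)) (f : (Fin d → ℝ) → ℝ≥0∞) (x : Fin d → ℝ) : ℝ≥0∞ :=
  ⨆ (c : Fin d → ℝ) (ρ : ℝ) (_ : x ∈ Metric.ball c ρ),
    (∫⁻ y in Metric.ball c ρ, f y ∂ν) / ν (Metric.ball c ρ)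

lemma le_mxOp {d : ℕ} (ν : Measure (Fin d → ℝ)) (f : (Fin d → ℝ) → ℝ≥0∞) {x c : Fin d → ℝ} {ρ : ℝ}
    (hx : x ∈ Metric.ball c ρ) :
    (∫⁻ y in Metric.ball c ρ, f y ∂ν) / ν (Metric.ball c ρ) ≤ mxOp ν f x :=
  le_iSup_of_le c (le_iSup_of_le ρ (le_iSup_of_le hx le_rfl))

lemma mxOp_lt_iff {d : ℕ} (ν : Measure (Fin d → ℝ)) (f : (Fin d → ℝ) → ℝ≥0∞) (x : Fin d → ℝ)
    (a : ℝ≥0∞) : a < mxOp ν f x ↔ ∃ (c : Fin d → ℝ) (ρ : ℝ), x ∈ Metric.ball c ρ ∧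
      a < (∫⁻ y in Metric.ball c ρ, f y ∂ν) / ν (Metric.ball c ρ) := by
  unfold mxOp
  simp only [lt_iSup_iff]
  simp only [exists_prop]

lemma measurable_mxOp {d : ℕ} (ν : Measure (Fin d → ℝ)) (f : (Fin d → ℝ) → ℝ≥0∞) :
    Measurable (mxOp ν f) := by
  apply measurable_of_Ioi
  intro a
  apply IsOpen.measurableSet
  rw [isOpen_iff_forall_mem_open]
  intro x hx
  obtain ⟨c, ρ, hxc, h⟩ := (mxOp_lt_iff ν f x a).1 hx
  exact ⟨Metric.ball c ρ, fun y hy => (mxOp_lt_iff ν f y a).2 ⟨c, ρ, hy, h⟩, Metric.isOpen_ball, hxc⟩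

/-- layer cake for extended nonnegative numbers -/
lemma layer_pt (x : ℝ≥0∞) {a : ℝ} (ha : 0 < a) :
    ENNReal.ofReal a * ∫⁻ l in Set.Ioi (0:ℝ), (if ENNReal.ofReal l < x then ENNReal.ofReal (l ^ (a - 1)) else 0)
      = x ^ a := by
  have key : ∀ n : ℝ, 0 ≤ n → ENNReal.ofReal a * ∫⁻ l in Set.Ioo (0:ℝ) n, ENNReal.ofReal (l ^ (a - 1))
      = ENNReal.ofReal n ^ a := by
    intro n hn
    rw [← ofReal_integral_eq_lintegral_ofReal]
    · rw [← integral_Ioc_eq_integral_Ioo, ← intervalIntegral.integral_of_le hn, integral_rpow (by left; linarith),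
        ← ENNReal.ofReal_mul ha.le, ENNReal.ofReal_rpow_of_nonneg hn ha.le]
      congr 1
      rw [sub_add_cancel, Real.zero_rpow ha.ne']
      field_simp
      ring
    · have := (intervalIntegral.intervalIntegrable_rpow' (a := 0) (b := n) (r := a - 1) (by linarith))
      rw [intervalIntegrable_iff_integrableOn_Ioo_of_le hn] at this
      exact this
    · filter_upwards [self_mem_ae_restrict measurableSet_Ioo] with l hl
      exact Real.rpow_nonneg hl.1.le _
  have conv : ∀ s : Set ℝ, MeasurableSet s → (∀ l ∈ s, 0 < l) → (∀ l, 0 < l → (ENNReal.ofReal l < x ↔ l ∈ s)) →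
     ∫⁻ l in Set.Ioi (0:ℝ), (if ENNReal.ofReal l < x then ENNReal.ofReal (l ^ (a - 1)) else 0) =
      ∫⁻ l in s, ENNReal.ofReal (l ^ (a - 1)) := by
    intro s hs h0 h
    rw [← lintegral_indicator measurableSet_Ioi, ← lintegral_indicator hs]
    congr 1
    ext l
    by_cases hl : 0 < l
    · by_cases h2 : l ∈ s
      · simp [Set.indicator, hl, h2, (h l hl).2 h2]
      · have : ¬ (ENNReal.ofReal l < x) := fun h3 => h2 ((h l hl).1 h3)
        simp [Set.indicator, hl, h2, this]
    · have : l ∉ s := fun h3 => hl (h0 l h3)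
      simp [Set.indicator, hl, this]
  rcases eq_or_ne x ∞ with rfl | hx
  · rw [ENNReal.top_rpow_of_pos ha, conv (Set.Ioi 0) measurableSet_Ioi (fun l hl => hl) (by simp)]
    apply ENNReal.eq_top_of_forall_nnreal_le
    intro r
    have h1 := key ((r:ℝ) ^ (1 / a)) (by positivity)
    rw [ENNReal.ofReal_rpow_of_nonneg (by positivity) ha.le, ← Real.rpow_mul (by positivity),
      one_div_mul_cancel ha.ne', Real.rpow_one, ENNReal.ofReal_coe_nnreal] at h1
    rw [← h1]
    gcongr
    exact Set.Ioo_subset_Ioi_self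
  · rw [conv (Set.Ioo 0 x.toReal) measurableSet_Ioo (fun l hl => hl.1), key _ ENNReal.toReal_nonneg,
      ENNReal.ofReal_toReal hx]
    intro l hl
    rw [ENNReal.ofReal_lt_iff_lt_toReal hl.le hx]
    simp [hl]

lemma layer_int {α : Type*} [MeasurableSpace α] (ν : Measure α) [SFinite ν] (f g : α → ℝ≥0∞)
    (hf : Measurable f) (hg : Measurable g) {a : ℝ} (ha : 0 < a) :
    ∫⁻ x, g x * f x ^ a ∂ν = ENNReal.ofReal a * ∫⁻ l in Set.Ioi (0:ℝ),
      ENNReal.ofReal (l ^ (a - 1)) * ∫⁻ x in {x | ENNReal.ofReal l < f x}, g x ∂ν := by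
  have hm : ∀ l : ℝ, MeasurableSet {x | ENNReal.ofReal l < f x} := fun l =>
    measurableSet_lt measurable_const hf
  have hmeas : Measurable (fun q : α × ℝ => g q.1 * (if ENNReal.ofReal q.2 < f q.1 then ENNReal.ofReal (q.2 ^ (a - 1)) else 0)) := by
    apply Measurable.mul (by fun_prop)
    apply Measurable.ite
    · exact measurableSet_lt (by fun_prop) (by fun_prop)
    · fun_prop
    · fun_prop
  have hmeas2 : ∀ x, Measurable (fun l : ℝ => (if ENNReal.ofReal l < f x then ENNReal.ofReal (l ^ (a - 1)) else 0)) := by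
    intro x
    apply Measurable.ite
    · exact measurableSet_lt (by fun_prop) (by fun_prop)
    · fun_prop
    · fun_prop
  calc ∫⁻ x, g x * f x ^ a ∂ν = ∫⁻ x, (ENNReal.ofReal a * ∫⁻ l in Set.Ioi (0:ℝ), g x *
        (if ENNReal.ofReal l < f x then ENNReal.ofReal (l ^ (a - 1)) else 0)) ∂ν := by
        congr 1; ext x
        rw [← layer_pt (f x) ha, lintegral_const_mul _ (hmeas2 x)]
        ring
    _ = ENNReal.ofReal a * ∫⁻ x, (∫⁻ l in Set.Ioi (0:ℝ), g x *
        (if ENNReal.ofReal l < f x then ENNReal.ofReal (l ^ (a - 1)) else 0)) ∂ν := by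
        rw [lintegral_const_mul' _ _ ENNReal.ofReal_ne_top]
    _ = _ := by
        rw [lintegral_lintegral_swap (by exact hmeas.aemeasurable)]
        congr 2
        ext l
        rw [← lintegral_const_mul _ hg, ← lintegral_indicator (hm l)]
        congr 1
        ext x
        by_cases h : ENNReal.ofReal l < f x
        · simp [Set.indicator, h, mul_comm]
        · simp [Set.indicator, h]

lemma weak_mxOp {d : ℕ} (ν : Measure (Fin d → ℝ)) (A : ℝ≥0∞)
    (hA : ∀ (c : Fin d → ℝ) (ρ : ℝ), 0 < ρ → ν (Metric.ball c (6 * ρ)) ≤ A * ν (Metric.ball c ρ))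
    (f : (Fin d → ℝ) → ℝ≥0∞) (l : ℝ≥0∞) :
    l * ν {x | l < mxOp ν f x} ≤ A * ∫⁻ x, f x ∂ν := by
  let U : ℕ → Set (Fin d → ℝ) := fun n => {x | ∃ (c : Fin d → ℝ) (ρ : ℝ), ρ ≤ n ∧ x ∈ Metric.ball c ρ ∧
      l < (∫⁻ y in Metric.ball c ρ, f y ∂ν) / ν (Metric.ball c ρ)}
  have hU : {x | l < mxOp ν f x} = ⋃ n, U n := by
    ext x
    simp only [Set.mem_ofPred_eq, Set.mem_iUnion, mxOp_lt_iff, U]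
    constructor
    · rintro ⟨c, ρ, h1, h2⟩
      obtain ⟨n, hn⟩ := exists_nat_ge ρ
      exact ⟨n, c, ρ, hn, h1, h2⟩
    · rintro ⟨n, c, ρ, hn, h1, h2⟩
      exact ⟨c, ρ, h1, h2⟩
  have hmono : Monotone U := by
    rintro n k hnk x ⟨c, ρ, hn, h1, h2⟩
    exact ⟨c, ρ, hn.trans (by exact_mod_cast hnk), h1, h2⟩
  rw [hU, hmono.measure_iUnion, ENNReal.mul_iSup]
  apply iSup_le
  intro n
  let T : Set ((Fin d → ℝ) × ℝ) := {b | 0 < b.2 ∧ b.2 ≤ n ∧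
      l < (∫⁻ y in Metric.ball b.1 b.2, f y ∂ν) / ν (Metric.ball b.1 b.2)}
  obtain ⟨u, huT, hdisj, hcov⟩ := Vitali.exists_disjoint_subfamily_covering_enlargement_closedBall T
    (fun b => b.1) (fun b => b.2) n (fun a ha => ha.2.1) 5 (by norm_num)
  have hdisj' : u.PairwiseDisjoint (fun b => Metric.ball b.1 b.2) := by
    intro a ha b hb hab
    exact (hdisj ha hb hab).mono Metric.ball_subset_closedBall Metric.ball_subset_closedBall
  have hcount : u.Countable := hdisj'.countable_of_isOpen (fun _ _ => Metric.isOpen_ball)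
    (fun b hb => Metric.nonempty_ball.2 (huT hb).1)
  have hsub : U n ⊆ ⋃ b ∈ u, Metric.ball b.1 (6 * b.2) := by
    rintro x ⟨c, ρ, hn, h1, h2⟩
    have hρ : 0 < ρ := Metric.pos_of_mem_ball h1
    obtain ⟨b, hb, hsub⟩ := hcov (c, ρ) ⟨hρ, hn, h2⟩
    simp only [Set.mem_iUnion]
    refine ⟨b, hb, ?_⟩
    have h3 := hsub (Metric.ball_subset_closedBall h1)
    have h4 := (huT hb).1
    rw [Metric.mem_closedBall] at h3
    rw [Metric.mem_ball]
    linarith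
  calc l * ν (U n) ≤ l * ∑' b : u, ν (Metric.ball b.1.1 (6 * b.1.2)) := by
        gcongr
        exact (measure_mono hsub).trans (measure_biUnion_le ν hcount _)
    _ ≤ l * ∑' b : u, A * ν (Metric.ball b.1.1 b.1.2) := by
        gcongr with b
        exact hA _ _ (huT b.2).1
    _ = A * ∑' b : u, l * ν (Metric.ball b.1.1 b.1.2) := by
        rw [ENNReal.tsum_mul_left, ENNReal.tsum_mul_left]; ring
    _ ≤ A * ∑' b : u, ∫⁻ y in Metric.ball b.1.1 b.1.2, f y ∂ν := by
        gcongr with b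
        exact ENNReal.mul_le_of_le_div (huT b.2).2.2.le
    _ = A * ∫⁻ y in ⋃ b ∈ u, Metric.ball b.1 b.2, f y ∂ν := by
        rw [lintegral_biUnion hcount (fun _ _ => Metric.isOpen_ball.measurableSet) hdisj']
    _ ≤ A * ∫⁻ x, f x ∂ν := by
        gcongr
        exact Measure.restrict_le_self

lemma mxOp_split {d : ℕ} (ν : Measure (Fin d → ℝ)) (f : (Fin d → ℝ) → ℝ≥0∞) (hf : Measurable f)
    (l : ℝ≥0∞) (x : Fin d → ℝ) :
    mxOp ν f x ≤ mxOp ν ({y | l < f y}.indicator f) x + l := by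
  have hm : MeasurableSet {y | l < f y} := measurableSet_lt measurable_const hf
  unfold mxOp
  refine iSup_le fun c => iSup_le fun ρ => iSup_le fun hx => ?_
  refine le_trans ?_ (add_le_add_left (le_mxOp ν _ hx) _)
  have h1 : ∫⁻ y in Metric.ball c ρ, f y ∂ν ≤ (∫⁻ y in Metric.ball c ρ, {y | l < f y}.indicator f y ∂ν)
      + l * ν (Metric.ball c ρ) := by
    rw [← setLIntegral_const, ← lintegral_add_right _ measurable_const]
    apply lintegral_mono
    intro y
    by_cases h : l < f y
    · simp [Set.indicator, h]
    · simp only [Set.indicator, Set.mem_ofPred_eq, h, if_false, zero_add]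
      exact not_lt.1 h
  calc _ ≤ ((∫⁻ y in Metric.ball c ρ, {y | l < f y}.indicator f y ∂ν)
      + l * ν (Metric.ball c ρ)) / ν (Metric.ball c ρ) := by gcongr
    _ ≤ _ := by
      rw [ENNReal.add_div]
      gcongr
      rw [mul_div_assoc]
      exact mul_le_of_le_one_right' ENNReal.div_self_le_one

lemma strong_mxOp {d : ℕ} (A : ℝ≥0∞) (hAt : A ≠ ∞) (t : ℝ) (ht : 1 < t) :
    ∃ C : ℝ≥0∞, C ≠ ∞ ∧ ∀ (ν : Measure (Fin d → ℝ)) [SFinite ν],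
    (∀ (c : Fin d → ℝ) (ρ : ℝ), 0 < ρ → ν (Metric.ball c (6 * ρ)) ≤ A * ν (Metric.ball c ρ)) →
    ∀ f : (Fin d → ℝ) → ℝ≥0∞, Measurable f → ∫⁻ x, mxOp ν f x ^ t ∂ν ≤ C * ∫⁻ x, f x ^ t ∂ν := by
  have ht0 : 0 < t := by linarith
  have ht1 : 0 < t - 1 := by linarith
  refine ⟨ENNReal.ofReal t * (2 * A * (2 ^ (t - 1) / ENNReal.ofReal (t - 1))), ?_, ?_⟩
  · have : (2:ℝ≥0∞) ^ (t - 1) / ENNReal.ofReal (t - 1) ≠ ∞ :=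
      ENNReal.div_ne_top (ENNReal.rpow_ne_top_of_nonneg ht1.le (by simp)) (by simpa using ht)
    finiteness
  intro ν _ hA f hf
  have h1 := layer_int ν (mxOp ν f) (fun _ => 1) (measurable_mxOp ν f) measurable_const ht0
  simp only [one_mul, setLIntegral_one] at h1
  rw [h1, mul_assoc]
  gcongr
  have h2 := layer_int ν (fun x => 2 * f x) f (by fun_prop) hf ht1
  have h3 : ∀ l ∈ Set.Ioi (0:ℝ), ENNReal.ofReal (l ^ (t - 1)) * ν {x | ENNReal.ofReal l < mxOp ν f x} ≤
      2 * A * (ENNReal.ofReal (l ^ (t - 1 - 1)) * ∫⁻ x in {x | ENNReal.ofReal l < 2 * f x}, f x ∂ν) := by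
    intro l hl
    have hl : 0 < l := hl
    have h4 : l ^ (t - 1) = l ^ (t - 1 - 1) * l := by
      rw [← Real.rpow_add_one hl.ne']; simp
    have hm : MeasurableSet {x | ENNReal.ofReal (l/2) < f x} := measurableSet_lt measurable_const hf
    have hset : {x | ENNReal.ofReal (l/2) < f x} = {x | ENNReal.ofReal l < 2 * f x} := by
      ext x
      simp only [Set.mem_ofPred_eq]
      rw [ENNReal.ofReal_div_of_pos (by norm_num), ENNReal.div_lt_iff (by simp) (by simp), mul_comm]
      simp
    have h5 := weak_mxOp ν A hA ({x | ENNReal.ofReal (l/2) < f x}.indicator f) (ENNReal.ofReal (l/2))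
    rw [lintegral_indicator hm, hset] at h5
    have hsub : {x | ENNReal.ofReal l < mxOp ν f x} ⊆
        {x | ENNReal.ofReal (l/2) < mxOp ν ({x | ENNReal.ofReal l < 2 * f x}.indicator f) x} := by
      intro x hx
      simp only [Set.mem_ofPred_eq] at hx ⊢
      by_contra hcon
      have h6 := mxOp_split ν f hf (ENNReal.ofReal (l/2)) x
      rw [hset] at h6
      have h7 := h6.trans (add_le_add_left (not_lt.1 hcon) _)
      rw [← ENNReal.ofReal_add (by positivity) (by positivity), add_halves] at h7
      exact absurd hx (not_lt.2 h7)
    rw [h4, ENNReal.ofReal_mul (by positivity)]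
    have hl2 : ENNReal.ofReal l = 2 * ENNReal.ofReal (l/2) := by
      rw [show (2:ℝ≥0∞) = ENNReal.ofReal 2 by simp, ← ENNReal.ofReal_mul (by norm_num)]
      congr 1; ring
    calc _ ≤ ENNReal.ofReal (l ^ (t - 1 - 1)) * (2 * ENNReal.ofReal (l/2)) * ν {x | ENNReal.ofReal (l/2) < mxOp ν ({x | ENNReal.ofReal l < 2 * f x}.indicator f) x} := by
          rw [← hl2]
          gcongr
      _ = ENNReal.ofReal (l ^ (t - 1 - 1)) * 2 * (ENNReal.ofReal (l/2) * ν {x | ENNReal.ofReal (l/2) < mxOp ν ({x | ENNReal.ofReal l < 2 * f x}.indicator f) x}) := by ring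
      _ ≤ ENNReal.ofReal (l ^ (t - 1 - 1)) * 2 * (A * ∫⁻ x in {x | ENNReal.ofReal l < 2 * f x}, f x ∂ν) := by
          gcongr
      _ = _ := by ring
  calc _ ≤ ∫⁻ l in Set.Ioi (0:ℝ), 2 * A * (ENNReal.ofReal (l ^ (t - 1 - 1)) * ∫⁻ x in {x | ENNReal.ofReal l < 2 * f x}, f x ∂ν) :=
        setLIntegral_mono' measurableSet_Ioi h3
    _ = 2 * A * ∫⁻ l in Set.Ioi (0:ℝ), (ENNReal.ofReal (l ^ (t - 1 - 1)) * ∫⁻ x in {x | ENNReal.ofReal l < 2 * f x}, f x ∂ν) := by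
        rw [lintegral_const_mul' _ _ (by finiteness)]
    _ = 2 * A * ((∫⁻ x, f x * (2 * f x) ^ (t - 1) ∂ν) / ENNReal.ofReal (t - 1)) := by
        rw [h2, mul_comm (ENNReal.ofReal (t-1)), ENNReal.mul_div_cancel_right (by simpa using ht) (by simp)]
    _ = _ := by
        have : ∀ x, f x * (2 * f x) ^ (t - 1) = 2 ^ (t - 1) * f x ^ t := by
          intro x
          rw [ENNReal.mul_rpow_of_nonneg _ _ ht1.le]
          have : f x ^ t = f x ^ (t - 1) * f x := by
            conv_lhs => rw [show t = (t - 1) + 1 by ring]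
            rw [ENNReal.rpow_add_of_nonneg _ _ ht1.le zero_le_one, ENNReal.rpow_one]
          rw [this]; ring
        simp_rw [this]
        rw [lintegral_const_mul _ (by fun_prop)]
        simp only [div_eq_mul_inv]
        ring


/-- Muckenhoupt `A_1` weights (strictly positive, a.e. finite). -/
def IsA1 {d : ℕ} (K : ℝ≥0∞) (v : (Fin d → ℝ) → ℝ≥0∞) : Prop :=
  Measurable v ∧ (∀ x, v x ≠ 0) ∧ (∀ᵐ x, v x ≠ ∞) ∧
    ∀ (c : Fin d → ℝ) (ρ : ℝ) (x : Fin d → ℝ), x ∈ Metric.ball c ρ →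
      ∫⁻ y in Metric.ball c ρ, v y ≤ K * volume (Metric.ball c ρ) * v x

lemma vol_ball_six {d : ℕ} (c : Fin d → ℝ) (ρ : ℝ) (hρ : 0 < ρ) :
    volume (Metric.ball c (6 * ρ)) = 6 ^ d * volume (Metric.ball c ρ) := by
  rw [Real.volume_pi_ball _ hρ, Real.volume_pi_ball _ (by positivity)]
  rw [show (6:ℝ≥0∞) = ENNReal.ofReal 6 by simp, ← ENNReal.ofReal_pow (by norm_num),
    ← ENNReal.ofReal_mul (by positivity)]
  congr 1
  rw [Fintype.card_fin, ← mul_pow]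
  ring

lemma vol_ball_ne_zero {d : ℕ} (c : Fin d → ℝ) (ρ : ℝ) (hρ : 0 < ρ) :
    volume (Metric.ball c ρ) ≠ 0 := (Metric.measure_ball_pos volume c hρ).ne'

lemma vol_ball_ne_top {d : ℕ} (c : Fin d → ℝ) (ρ : ℝ) :
    volume (Metric.ball c ρ) ≠ ∞ := measure_ball_lt_top.ne

lemma IsA1.doubling {d : ℕ} {K : ℝ≥0∞} {v : (Fin d → ℝ) → ℝ≥0∞} (hv : IsA1 K v)
    (c : Fin d → ℝ) (ρ : ℝ) (hρ : 0 < ρ) :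
    (volume.withDensity v) (Metric.ball c (6 * ρ)) ≤ (K * 6 ^ d) * (volume.withDensity v) (Metric.ball c ρ) := by
  obtain ⟨h1, h2, h3, h4⟩ := hv
  rw [withDensity_apply _ Metric.isOpen_ball.measurableSet, withDensity_apply _ Metric.isOpen_ball.measurableSet]
  have h5 : volume (Metric.ball c ρ) * ∫⁻ y in Metric.ball c (6 * ρ), v y ≤
      volume (Metric.ball c ρ) * ((K * 6 ^ d) * ∫⁻ y in Metric.ball c ρ, v y) := by
    calc _ = ∫⁻ x in Metric.ball c ρ, (∫⁻ y in Metric.ball c (6 * ρ), v y) := by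
          rw [setLIntegral_const, mul_comm]
      _ ≤ ∫⁻ x in Metric.ball c ρ, K * volume (Metric.ball c (6 * ρ)) * v x := by
          apply setLIntegral_mono' Metric.isOpen_ball.measurableSet
          intro x hx
          exact h4 c (6 * ρ) x (Metric.ball_subset_ball (by linarith) hx)
      _ = _ := by
          rw [lintegral_const_mul _ h1, vol_ball_six c ρ hρ]
          ring
  exact (ENNReal.mul_le_mul_iff_right (vol_ball_ne_zero c ρ hρ) (vol_ball_ne_top c ρ)).1 h5

lemma IsA1.one {d : ℕ} : IsA1 (d := d) 1 (fun _ => 1) := by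
  refine ⟨measurable_const, by simp, by simp, ?_⟩
  intro c ρ x hx
  simp

lemma IsA1.int_ne_zero {d : ℕ} {K : ℝ≥0∞} {v : (Fin d → ℝ) → ℝ≥0∞} (hv : IsA1 K v)
    (c : Fin d → ℝ) (ρ : ℝ) (hρ : 0 < ρ) : ∫⁻ y in Metric.ball c ρ, v y ≠ 0 := by
  intro h
  rw [setLIntegral_eq_zero_iff Metric.isOpen_ball.measurableSet hv.1] at h
  have : volume (Metric.ball c ρ) = 0 := by
    rw [← nonpos_iff_eq_zero, ← (ae_iff.1 h)]
    apply measure_mono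
    intro x hx
    simp only [Set.mem_ofPred_eq]
    intro h'
    exact hv.2.1 x (h' hx)
  exact vol_ball_ne_zero c ρ hρ this

lemma IsA1.int_ne_top {d : ℕ} {K : ℝ≥0∞} {v : (Fin d → ℝ) → ℝ≥0∞} (hv : IsA1 K v) (hK : K ≠ ∞)
    (c : Fin d → ℝ) (ρ : ℝ) (hρ : 0 < ρ) : ∫⁻ y in Metric.ball c ρ, v y ≠ ∞ := by
  have : ∃ x ∈ Metric.ball c ρ, v x ≠ ∞ := by
    by_contra hcon
    push Not at hcon
    apply vol_ball_ne_zero c ρ hρ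
    rw [← nonpos_iff_eq_zero, ← (ae_iff.1 hv.2.2.1)]
    apply measure_mono
    intro x hx
    simp [hcon x hx]
  obtain ⟨x, hx, hvx⟩ := this
  have := hv.2.2.2 c ρ x hx
  have h2 := vol_ball_ne_top c ρ
  exact ne_top_of_le_ne_top (by finiteness) this

lemma IsA1.mx_le {d : ℕ} {K : ℝ≥0∞} {v : (Fin d → ℝ) → ℝ≥0∞} (hv : IsA1 K v) (hK : K ≠ ∞)
    (G : (Fin d → ℝ) → ℝ≥0∞) (hG : Measurable G) (x : Fin d → ℝ) :
    mxOp volume G x ≤ K * mxOp (volume.withDensity v) G x := by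
  unfold mxOp
  refine iSup_le fun c => iSup_le fun ρ => iSup_le fun hx => ?_
  have hρ := Metric.pos_of_mem_ball hx
  refine le_trans ?_ (mul_le_mul_right (le_mxOp (volume.withDensity v) G hx) _)
  rw [withDensity_apply _ Metric.isOpen_ball.measurableSet,
    setLIntegral_withDensity_eq_setLIntegral_mul _ hv.1 hG Metric.isOpen_ball.measurableSet]
  have h1 : (∫⁻ y in Metric.ball c ρ, G y) * (∫⁻ y in Metric.ball c ρ, v y) ≤
      K * volume (Metric.ball c ρ) * ∫⁻ y in Metric.ball c ρ, (v * G) y := by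
    rw [← lintegral_mul_const _ hG, ← lintegral_const_mul _ (hv.1.mul hG)]
    apply setLIntegral_mono' Metric.isOpen_ball.measurableSet
    intro y hy
    calc _ ≤ G y * (K * volume (Metric.ball c ρ) * v y) := by
          gcongr
          exact hv.2.2.2 c ρ y hy
      _ = _ := by simp only [Pi.mul_apply]; ring
  rw [ENNReal.div_le_iff (vol_ball_ne_zero c ρ hρ) (vol_ball_ne_top c ρ)]
  rw [← mul_div_assoc, mul_comm, ← mul_div_assoc]
  rw [ENNReal.le_div_iff_mul_le (Or.inl (hv.int_ne_zero c ρ hρ)) (Or.inl (hv.int_ne_top hK c ρ hρ))]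
  calc _ ≤ _ := h1
    _ = _ := by ring

lemma IsA1.mx_le' {d : ℕ} {K : ℝ≥0∞} {v : (Fin d → ℝ) → ℝ≥0∞} (hv : IsA1 K v) (hK : K ≠ ∞)
    (G : (Fin d → ℝ) → ℝ≥0∞) (hG : Measurable G) (x : Fin d → ℝ) :
    mxOp volume G x ≤ K * v x * mxOp (volume.withDensity v) (fun y => G y / v y) x := by
  unfold mxOp
  refine iSup_le fun c => iSup_le fun ρ => iSup_le fun hx => ?_
  have hρ := Metric.pos_of_mem_ball hx
  refine le_trans ?_ (mul_le_mul_right (le_mxOp (volume.withDensity v) (fun y => G y / v y) hx) _)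
  rw [withDensity_apply _ Metric.isOpen_ball.measurableSet,
    setLIntegral_withDensity_eq_setLIntegral_mul _ (g := fun y => G y / v y) hv.1 (hG.div hv.1) Metric.isOpen_ball.measurableSet]
  have h1 : ∫⁻ y in Metric.ball c ρ, (v * fun y => G y / v y) y = ∫⁻ y in Metric.ball c ρ, G y := by
    apply lintegral_congr_ae
    filter_upwards [ae_restrict_of_ae hv.2.2.1] with y hy
    simp only [Pi.mul_apply]
    exact ENNReal.mul_div_cancel (hv.2.1 y) hy
  rw [h1, ENNReal.div_le_iff (vol_ball_ne_zero c ρ hρ) (vol_ball_ne_top c ρ)]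
  have h2 := hv.2.2.2 c ρ x hx
  calc ∫⁻ y in Metric.ball c ρ, G y = (∫⁻ y in Metric.ball c ρ, v y) * ((∫⁻ y in Metric.ball c ρ, G y) / ∫⁻ y in Metric.ball c ρ, v y) :=
        (ENNReal.mul_div_cancel (hv.int_ne_zero c ρ hρ) (hv.int_ne_top hK c ρ hρ)).symm
    _ ≤ (K * volume (Metric.ball c ρ) * v x) * ((∫⁻ y in Metric.ball c ρ, G y) / ∫⁻ y in Metric.ball c ρ, v y) := by gcongr
    _ = _ := by ring

/-- weighted strong type, both forms -/
lemma weighted_strong {d : ℕ} (K : ℝ≥0∞) (hK : K ≠ ∞) (t : ℝ) (ht : 1 < t) :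
    ∃ C : ℝ≥0∞, C ≠ ∞ ∧ ∀ v : (Fin d → ℝ) → ℝ≥0∞, IsA1 K v → ∀ G : (Fin d → ℝ) → ℝ≥0∞, Measurable G →
      (∫⁻ x, mxOp volume G x ^ t * v x ≤ C * ∫⁻ x, G x ^ t * v x) ∧
      (∫⁻ x, mxOp volume G x ^ t * v x ^ (1 - t) ≤ C * ∫⁻ x, G x ^ t * v x ^ (1 - t)) := by
  have ht0 : 0 < t := by linarith
  obtain ⟨C, hC, h⟩ := strong_mxOp (d := d) (K * 6 ^ d) (by finiteness) t ht
  refine ⟨K ^ t * C, ENNReal.mul_ne_top (ENNReal.rpow_ne_top_of_nonneg ht0.le hK) hC, ?_⟩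
  intro v hv G hG
  have hKt : K ^ t ≠ ∞ := ENNReal.rpow_ne_top_of_nonneg ht0.le hK
  have h0 := h (volume.withDensity v) (fun c ρ hρ => hv.doubling c ρ hρ)
  have hconv : ∀ g : (Fin d → ℝ) → ℝ≥0∞, Measurable g → ∫⁻ x, mxOp (volume.withDensity v) g x ^ t * v x ≤
      C * ∫⁻ x, g x ^ t * v x := by
    intro g hg
    have := h0 g hg
    rw [lintegral_withDensity_eq_lintegral_mul _ hv.1 ((measurable_mxOp _ _).pow_const t),
      lintegral_withDensity_eq_lintegral_mul _ hv.1 (hg.pow_const t)] at this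
    simpa only [Pi.mul_apply, mul_comm] using this
  constructor
  · calc _ ≤ ∫⁻ x, K ^ t * (mxOp (volume.withDensity v) G x ^ t * v x) := by
          apply lintegral_mono
          intro x
          show mxOp volume G x ^ t * v x ≤ K ^ t * (mxOp (volume.withDensity v) G x ^ t * v x)
          rw [← mul_assoc, ← ENNReal.mul_rpow_of_nonneg _ _ ht0.le]
          gcongr
          exact hv.mx_le hK G hG x
      _ = K ^ t * ∫⁻ x, (mxOp (volume.withDensity v) G x ^ t * v x) := by
          rw [lintegral_const_mul' _ _ hKt]
      _ ≤ _ := by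
          rw [mul_assoc]
          gcongr
          exact hconv G hG
  · have hpow : ∀ x, v x ≠ ∞ → v x ^ t * v x ^ (1 - t) = v x := by
      intro x hx
      rw [← ENNReal.rpow_add _ _ (hv.2.1 x) hx]; simp
    calc _ ≤ ∫⁻ x, K ^ t * (mxOp (volume.withDensity v) (fun y => G y / v y) x ^ t * v x) := by
          apply lintegral_mono_ae
          filter_upwards [hv.2.2.1] with x hx
          calc mxOp volume G x ^ t * v x ^ (1 - t) ≤ (K * v x * mxOp (volume.withDensity v) (fun y => G y / v y) x) ^ t * v x ^ (1 - t) := by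
                gcongr
                exact hv.mx_le' hK G hG x
            _ = K ^ t * (mxOp (volume.withDensity v) (fun y => G y / v y) x ^ t * (v x ^ t * v x ^ (1 - t))) := by
                rw [ENNReal.mul_rpow_of_nonneg _ _ ht0.le, ENNReal.mul_rpow_of_nonneg _ _ ht0.le]
                ring
            _ = _ := by rw [hpow x hx]
      _ = K ^ t * ∫⁻ x, (mxOp (volume.withDensity v) (fun y => G y / v y) x ^ t * v x) := by
          rw [lintegral_const_mul' _ _ hKt]
      _ ≤ K ^ t * (C * ∫⁻ x, (G x / v x) ^ t * v x) := by
          gcongr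
          exact hconv _ (hG.div hv.1)
      _ = _ := by
          rw [mul_assoc]
          congr 2
          apply lintegral_congr_ae
          filter_upwards [hv.2.2.1] with x hx
          rw [ENNReal.div_rpow_of_nonneg _ _ ht0.le, div_eq_mul_inv, ← ENNReal.rpow_neg, mul_assoc]
          congr 1
          nth_rw 2 [← ENNReal.rpow_one (v x)]
          rw [← ENNReal.rpow_add _ _ (hv.2.1 x) hx]
          congr 1; ring

lemma IsA1.rpow {d : ℕ} {K : ℝ≥0∞} {v : (Fin d → ℝ) → ℝ≥0∞} (hv : IsA1 K v)
    {δ : ℝ} (h0 : 0 ≤ δ) (h1 : δ ≤ 1) : IsA1 (K ^ δ) (fun x => v x ^ δ) := by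
  refine ⟨hv.1.pow_const δ, ?_, ?_, ?_⟩
  · intro x h
    rw [ENNReal.rpow_eq_zero_iff] at h
    rcases h with h | h
    · exact hv.2.1 x h.1
    · linarith [h.2]
  · filter_upwards [hv.2.2.1] with x hx
    exact ENNReal.rpow_ne_top_of_nonneg h0 hx
  · intro c ρ x hx
    have hρ := Metric.pos_of_mem_ball hx
    have h := ENNReal.lintegral_mul_norm_pow_le (μ := volume.restrict (Metric.ball c ρ)) (f := v) (g := fun _ => 1)
      hv.1.aemeasurable measurable_const.aemeasurable h0 (q := 1 - δ) (by linarith) (by ring)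
    simp only [ENNReal.one_rpow, mul_one, setLIntegral_one] at h
    refine h.trans ?_
    calc _ ≤ (K * volume (Metric.ball c ρ) * v x) ^ δ * volume (Metric.ball c ρ) ^ (1 - δ) := by
          gcongr
          exact hv.2.2.2 c ρ x hx
      _ = K ^ δ * (volume (Metric.ball c ρ) ^ δ * volume (Metric.ball c ρ) ^ (1 - δ)) * v x ^ δ := by
          rw [ENNReal.mul_rpow_of_nonneg _ _ h0, ENNReal.mul_rpow_of_nonneg _ _ h0]
          ring
      _ = _ := by
          rw [← ENNReal.rpow_add _ _ (vol_ball_ne_zero c ρ hρ) (vol_ball_ne_top c ρ)]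
          simp

lemma pow_rpow_swap (z : ℝ≥0∞) (k : ℕ) (q : ℝ) : (z ^ k) ^ q = (z ^ q) ^ k := by
  rw [← ENNReal.rpow_natCast, ← ENNReal.rpow_natCast, ← ENNReal.rpow_mul, ← ENNReal.rpow_mul, mul_comm]

/-- Rubio de Francia -/
lemma rubio {d : ℕ} (q : ℝ) (hq : 1 < q) :
    ∃ K C : ℝ≥0∞, K ≠ ∞ ∧ C ≠ ∞ ∧ ∀ h : (Fin d → ℝ) → ℝ≥0∞, Measurable h →
      ∫⁻ x, h x ^ q ≠ 0 → ∫⁻ x, h x ^ q ≠ ∞ →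
      ∃ u : (Fin d → ℝ) → ℝ≥0∞, IsA1 K u ∧ (∀ x, h x ≤ u x) ∧ ∫⁻ x, u x ^ q ≤ C * ∫⁻ x, h x ^ q := by
  have hq0 : 0 < q := by linarith
  obtain ⟨A0, hA0, hs0⟩ := strong_mxOp (d := d) (1 * 6 ^ d) (by finiteness) q hq
  have hs1 : ∃ A : ℝ≥0∞, A ≠ 0 ∧ A ≠ ∞ ∧ ∀ f : (Fin d → ℝ) → ℝ≥0∞, Measurable f →
      ∫⁻ x, mxOp volume f x ^ q ≤ A * ∫⁻ x, f x ^ q := by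
    refine ⟨A0 + 1, by simp, by finiteness, ?_⟩
    intro f hf
    refine (hs0 volume ?_ f hf).trans ?_
    · intro c ρ hρ
      rw [vol_ball_six c ρ hρ, one_mul]
    · gcongr
      exact le_self_add
  obtain ⟨A, hA, hAt, hs⟩ := hs1
  -- `c` chosen with `(2 c)^q A = 1/2`
  set e : ℝ≥0∞ := (2⁻¹ * A⁻¹) ^ (1 / q) with he
  have heq : e ^ q = 2⁻¹ * A⁻¹ := by
    rw [he, ← ENNReal.rpow_mul, one_div_mul_cancel hq0.ne', ENNReal.rpow_one]
  have hin : (2:ℝ≥0∞)⁻¹ * A⁻¹ ≠ 0 := mul_ne_zero (by simp) (by simpa using hAt)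
  have hin2 : (2:ℝ≥0∞)⁻¹ * A⁻¹ ≠ ∞ := ENNReal.mul_ne_top (by simp) (by simpa using hA)
  have he0 : e ≠ 0 := by
    rw [he]; intro h
    rw [ENNReal.rpow_eq_zero_iff] at h
    rcases h with h | h
    · exact hin h.1
    · exact hin2 h.1
  have het : e ≠ ∞ := ENNReal.rpow_ne_top_of_nonneg (by positivity) hin2
  set c : ℝ≥0∞ := 2⁻¹ * e with hc
  have hc0 : c ≠ 0 := mul_ne_zero (by simp) he0
  have hct : c ≠ ∞ := ENNReal.mul_ne_top (by simp) het
  refine ⟨c⁻¹, 2 ^ q * 2, by simpa using hc0, ENNReal.mul_ne_top (ENNReal.rpow_ne_top_of_nonneg hq0.le (by simp)) (by simp), ?_⟩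
  intro h hh hn0 hnt
  let Mk : ℕ → (Fin d → ℝ) → ℝ≥0∞ := fun k => (mxOp volume)^[k] h
  have hMk : ∀ k, Measurable (Mk k) := by
    intro k
    cases k with
    | zero => exact hh
    | succ k =>
      simp only [Mk, Function.iterate_succ', Function.comp]
      exact measurable_mxOp _ _
  have hMs : ∀ k, Mk (k + 1) = mxOp volume (Mk k) := by
    intro k
    simp only [Mk, Function.iterate_succ', Function.comp]
  have hMb : ∀ k, ∫⁻ x, Mk k x ^ q ≤ A ^ k * ∫⁻ x, h x ^ q := by
    intro k
    induction k with
    | zero => simp [Mk]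
    | succ k ih =>
      rw [hMs]
      refine (hs _ (hMk k)).trans ?_
      rw [pow_succ', mul_assoc]
      gcongr
  let u : (Fin d → ℝ) → ℝ≥0∞ := fun x => ∑' k, c ^ k * Mk k x
  have hum : Measurable u := Measurable.tsum fun k => (hMk k).const_mul _
  have hle : ∀ x, h x ≤ u x := by
    intro x
    have := ENNReal.le_tsum (f := fun k => c ^ k * Mk k x) 0
    simpa [Mk] using this
  have hA1 : ∀ (z : Fin d → ℝ) (ρ : ℝ) (x : Fin d → ℝ), x ∈ Metric.ball z ρ →
      ∫⁻ y in Metric.ball z ρ, u y ≤ c⁻¹ * volume (Metric.ball z ρ) * u x := by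
    intro z ρ x hx
    have hρ := Metric.pos_of_mem_ball hx
    calc ∫⁻ y in Metric.ball z ρ, u y = ∑' k, c ^ k * ∫⁻ y in Metric.ball z ρ, Mk k y := by
          simp only [u]
          rw [lintegral_tsum (fun k => ((hMk k).const_mul _).aemeasurable)]
          congr 1; ext k
          rw [lintegral_const_mul _ (hMk k)]
      _ ≤ ∑' k, c⁻¹ * volume (Metric.ball z ρ) * (c ^ (k+1) * Mk (k+1) x) := by
          refine ENNReal.tsum_le_tsum fun k => ?_
          have h1 : ∫⁻ y in Metric.ball z ρ, Mk k y ≤ Mk (k+1) x * volume (Metric.ball z ρ) := by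
            rw [hMs]
            rw [← ENNReal.div_le_iff (vol_ball_ne_zero z ρ hρ) (vol_ball_ne_top z ρ)]
            exact le_mxOp volume (Mk k) hx
          calc c ^ k * ∫⁻ y in Metric.ball z ρ, Mk k y ≤ (c⁻¹ * c) * c ^ k * (Mk (k+1) x * volume (Metric.ball z ρ)) := by
                rw [ENNReal.inv_mul_cancel hc0 hct, one_mul]
                gcongr
            _ = _ := by
                rw [pow_succ']
                generalize c⁻¹ = w
                ring
      _ = c⁻¹ * volume (Metric.ball z ρ) * ∑' k, (c ^ (k+1) * Mk (k+1) x) := by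
          rw [ENNReal.tsum_mul_left]
      _ ≤ _ := by
          gcongr
          exact ENNReal.tsum_comp_le_tsum_of_injective (add_left_injective 1) (fun k => c ^ k * Mk k x)
  have hnorm : ∫⁻ x, u x ^ q ≤ 2 ^ q * 2 * ∫⁻ x, h x ^ q := by
    have h1 : ∀ x, u x ^ q ≤ 2 ^ q * ∑' k, (e ^ k * Mk k x) ^ q := by
      intro x
      have h2 : u x ≤ 2 * ⨆ k, e ^ k * Mk k x := by
        calc u x = ∑' k, (2⁻¹:ℝ≥0∞) ^ k * (e ^ k * Mk k x) := by
              simp only [u, hc, mul_pow, mul_assoc]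
          _ ≤ ∑' k, (2⁻¹:ℝ≥0∞) ^ k * ⨆ k, e ^ k * Mk k x := by
              gcongr with k
              exact le_iSup (fun k => e ^ k * Mk k x) k
          _ = _ := by
              rw [ENNReal.tsum_mul_right, ENNReal.tsum_geometric]
              simp
      calc u x ^ q ≤ (2 * ⨆ k, e ^ k * Mk k x) ^ q := by gcongr
        _ = 2 ^ q * (⨆ k, e ^ k * Mk k x) ^ q := ENNReal.mul_rpow_of_nonneg _ _ hq0.le
        _ ≤ _ := by
            gcongr
            have := (ENNReal.orderIsoRpow q hq0).map_iSup (fun k => e ^ k * Mk k x)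
            simp only [ENNReal.orderIsoRpow_apply] at this
            rw [this]
            exact iSup_le fun k => ENNReal.le_tsum (f := fun k => (e ^ k * Mk k x) ^ q) k
    calc ∫⁻ x, u x ^ q ≤ ∫⁻ x, 2 ^ q * ∑' k, (e ^ k * Mk k x) ^ q := lintegral_mono h1
      _ = 2 ^ q * ∑' k, (e ^ q) ^ k * ∫⁻ x, Mk k x ^ q := by
          rw [lintegral_const_mul' _ _ (ENNReal.rpow_ne_top_of_nonneg hq0.le (by simp)),
            lintegral_tsum (fun k => (((hMk k).const_mul _).pow_const q).aemeasurable)]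
          congr 2; ext k
          rw [← lintegral_const_mul _ ((hMk k).pow_const q)]
          congr 1; ext x
          rw [ENNReal.mul_rpow_of_nonneg _ _ hq0.le, pow_rpow_swap]
      _ ≤ 2 ^ q * ∑' k, (e ^ q) ^ k * (A ^ k * ∫⁻ x, h x ^ q) := by
          gcongr with k
          exact hMb k
      _ = 2 ^ q * ∑' k, (2⁻¹:ℝ≥0∞) ^ k * ∫⁻ x, h x ^ q := by
          congr 2; ext k
          rw [heq, ← mul_assoc, ← mul_pow, mul_assoc (2⁻¹:ℝ≥0∞), ENNReal.inv_mul_cancel hA hAt, mul_one]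
      _ = _ := by
          rw [ENNReal.tsum_mul_right, ENNReal.tsum_geometric]
          simp
          ring
  have hnt' : ∫⁻ x, u x ^ q ≠ ∞ := ne_top_of_le_ne_top
    (ENNReal.mul_ne_top (ENNReal.mul_ne_top (ENNReal.rpow_ne_top_of_nonneg hq0.le (by simp)) (by simp)) hnt) hnorm
  refine ⟨u, ⟨hum, ?_, ?_, hA1⟩, hle, hnorm⟩
  · intro x hx
    apply hn0
    have hz : ∀ n : ℕ, ∀ᵐ y, y ∈ Metric.ball x (n + 1) → u y = 0 := by
      intro n
      have := hA1 x (n + 1) x (Metric.mem_ball_self (by positivity))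
      rw [hx, mul_zero, nonpos_iff_eq_zero, setLIntegral_eq_zero_iff Metric.isOpen_ball.measurableSet hum] at this
      exact this
    rw [lintegral_eq_zero_iff (hh.pow_const q)]
    filter_upwards [ae_all_iff.2 hz] with y hy
    obtain ⟨n, hn⟩ := exists_nat_ge (dist y x)
    have h0 : u y = 0 := hy n (by rw [Metric.mem_ball]; linarith)
    have h1 := hle y
    rw [h0, nonpos_iff_eq_zero] at h1
    simp [h1, hq0]
  · filter_upwards [ae_lt_top (hum.pow_const q) hnt'] with x hx
    intro hx'
    rw [hx', ENNReal.top_rpow_of_pos hq0] at hx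
    exact lt_irrefl _ hx


/-- An open ball (in the sup norm) containing the cube. -/
def bl {d : ℕ} (Q : Cube d) : Set (Fin d → ℝ) :=
  Metric.ball (fun i => Q.corner i + Q.side / 2) Q.side

/-- lattice maximal operator over a finite collection, exponent one -/
def nOp {d : ℕ} {Ω : Type} (D : Finset (Cube d)) (F : (Fin d → ℝ) → Ω → ℝ≥0∞)
    (x : Fin d → ℝ) (ω : Ω) : ℝ≥0∞ :=
  ⨆ Q ∈ D, ⨆ (_ : x ∈ bl Q), (∫⁻ y in bl Q, F y ω) / volume (bl Q)

lemma measurableSet_bl {d : ℕ} (Q : Cube d) : MeasurableSet (bl Q) := Metric.isOpen_ball.measurableSet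

lemma nOp_le {d : ℕ} {Ω : Type} (D : Finset (Cube d)) (F : (Fin d → ℝ) → Ω → ℝ≥0∞)
    (x : Fin d → ℝ) (ω : Ω) : nOp D F x ω ≤ mxOp volume (fun y => F y ω) x := by
  refine iSup_le fun Q => iSup_le fun _ => iSup_le fun hx => ?_
  exact le_mxOp volume _ hx

lemma measurable_section {d : ℕ} {Ω : Type} [MeasurableSpace Ω] {F : (Fin d → ℝ) → Ω → ℝ≥0∞}
    (hF : Measurable (Function.uncurry F)) (ω : Ω) : Measurable (fun y => F y ω) :=
  hF.comp (measurable_id.prodMk measurable_const)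

lemma measurable_section' {d : ℕ} {Ω : Type} [MeasurableSpace Ω] {F : (Fin d → ℝ) → Ω → ℝ≥0∞}
    (hF : Measurable (Function.uncurry F)) (x : Fin d → ℝ) : Measurable (F x) :=
  hF.comp (measurable_const.prodMk measurable_id)

lemma measurable_sup_fam {d : ℕ} {Ω : Type} [MeasurableSpace Ω] (D : Finset (Cube d))
    (a : Cube d → Ω → ℝ≥0∞) (ha : ∀ Q, Measurable (a Q)) :
    Measurable (Function.uncurry (fun (x : Fin d → ℝ) ω => ⨆ Q ∈ D, ⨆ (_ : x ∈ bl Q), a Q ω)) := by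
  have : (Function.uncurry (fun (x : Fin d → ℝ) ω => ⨆ Q ∈ D, ⨆ (_ : x ∈ bl Q), a Q ω)) =
      fun z => ⨆ Q ∈ (D : Set (Cube d)), ((bl Q) ×ˢ Set.univ).indicator (fun z => a Q z.2) z := by
    ext ⟨x, ω⟩
    simp only [Function.uncurry]
    congr 1; ext Q; congr 1; ext hQ
    by_cases hx : x ∈ bl Q <;> simp [hx]
  rw [this]
  apply Measurable.biSup _ D.countable_toSet
  intro Q _
  exact ((ha Q).comp measurable_snd).indicator ((measurableSet_bl Q).prod MeasurableSet.univ)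

lemma measurable_nOp {d : ℕ} {Ω : Type} [MeasurableSpace Ω] (D : Finset (Cube d))
    {F : (Fin d → ℝ) → Ω → ℝ≥0∞} (hF : Measurable (Function.uncurry F)) :
    Measurable (Function.uncurry (nOp D F)) := by
  apply measurable_sup_fam
  intro Q
  apply Measurable.div_const
  exact Measurable.lintegral_prod_left' (f := Function.uncurry F) hF

lemma nOp_zero {d : ℕ} {Ω : Type} (D : Finset (Cube d)) (F : (Fin d → ℝ) → Ω → ℝ≥0∞) (ω : Ω)
    (h : ∀ᵐ y, F y ω = 0) (x : Fin d → ℝ) : nOp D F x ω = 0 := by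
  rw [← nonpos_iff_eq_zero]
  refine iSup_le fun Q => iSup_le fun _ => iSup_le fun hx => ?_
  have : ∫⁻ y in bl Q, F y ω = 0 := by
    rw [← lintegral_zero (μ := volume.restrict (bl Q))]
    exact lintegral_congr_ae (ae_restrict_of_ae h)
  simp [this]

lemma tonelli_weight {d : ℕ} {Ω : Type} [MeasurableSpace Ω] (μ : Measure Ω) [SigmaFinite μ]
    (D : Finset (Cube d)) {F : (Fin d → ℝ) → Ω → ℝ≥0∞} (hF : Measurable (Function.uncurry F))
    (t : ℝ) (ht : 0 < t) (C : ℝ≥0∞) (W : (Fin d → ℝ) → ℝ≥0∞) (hW : Measurable W)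
    (h : ∀ G : (Fin d → ℝ) → ℝ≥0∞, Measurable G →
      ∫⁻ x, mxOp volume G x ^ t * W x ≤ C * ∫⁻ x, G x ^ t * W x) :
    ∫⁻ x, (∫⁻ ω, nOp D F x ω ^ t ∂μ) * W x ≤ C * ∫⁻ x, (∫⁻ ω, F x ω ^ t ∂μ) * W x := by
  have hN := measurable_nOp D hF
  have swap : ∀ G : (Fin d → ℝ) → Ω → ℝ≥0∞, Measurable (Function.uncurry G) →
      ∫⁻ x, (∫⁻ ω, G x ω ^ t ∂μ) * W x = ∫⁻ ω, (∫⁻ x, G x ω ^ t * W x) ∂μ := by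
    intro G hG
    rw [← lintegral_lintegral_swap]
    · congr 1; ext x
      rw [lintegral_mul_const _ ((measurable_section' hG x).pow_const t)]
    · apply Measurable.aemeasurable
      exact (hG.pow_const t).mul (hW.comp measurable_fst)
  rw [swap _ hN, swap _ hF]
  rw [← lintegral_const_mul]
  · apply lintegral_mono
    intro ω
    refine le_trans ?_ (h (fun y => F y ω) (measurable_section hF ω))
    apply lintegral_mono
    intro x
    show nOp D F x ω ^ t * W x ≤ mxOp volume (fun y => F y ω) x ^ t * W x
    gcongr
    exact nOp_le D F x ω
  · exact Measurable.lintegral_prod_left' (f := fun z : (Fin d → ℝ) × Ω => F z.1 z.2 ^ t * W z.1)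
      ((hF.pow_const t).mul (hW.comp measurable_fst))

lemma fs_low {d : ℕ} (p t : ℝ) (hp : 1 < p) (hpt : p ≤ t) :
    ∃ C : ℝ≥0∞, C ≠ ∞ ∧ ∀ (Ω : Type) [MeasurableSpace Ω] (μ : Measure Ω) [SigmaFinite μ]
      (D : Finset (Cube d)) (F : (Fin d → ℝ) → Ω → ℝ≥0∞), Measurable (Function.uncurry F) →
      ∫⁻ x, (∫⁻ ω, nOp D F x ω ^ t ∂μ) ^ (p / t) ≤ C * ∫⁻ x, (∫⁻ ω, F x ω ^ t ∂μ) ^ (p / t) := by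
  have hp0 : 0 < p := by linarith
  have ht0 : 0 < t := by linarith
  have ht1 : 0 < t - 1 := by linarith
  obtain ⟨K, Cr, hK, hCr, hrub⟩ := rubio (d := d) p hp
  set δ : ℝ := (t - p) / (t - 1) with hδ
  have hδ0 : 0 ≤ δ := div_nonneg (by linarith) ht1.le
  have hδ1 : δ ≤ 1 := by rw [hδ, div_le_one ht1]; linarith
  have hKδ : K ^ δ ≠ ∞ := ENNReal.rpow_ne_top_of_nonneg hδ0 hK
  obtain ⟨Cw, hCw, hw⟩ := weighted_strong (d := d) (K ^ δ) hKδ t (by linarith)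
  set θ := p / t with hθ
  have hθ0 : 0 < θ := div_pos hp0 ht0
  have hθ1 : θ ≤ 1 := by rw [hθ, div_le_one ht0]; exact hpt
  refine ⟨Cw ^ θ * Cr + 1, ?_, ?_⟩
  · have : Cw ^ θ ≠ ∞ := ENNReal.rpow_ne_top_of_nonneg hθ0.le hCw
    finiteness
  intro Ω _ μ _ D F hF
  have hN := measurable_nOp D hF
  have hkm : Measurable (fun x => ∫⁻ ω, F x ω ^ t ∂μ) :=
    Measurable.lintegral_prod_right' (f := fun z : (Fin d → ℝ) × Ω => F z.1 z.2 ^ t) (hF.pow_const t)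
  have hSm : Measurable (fun x => ∫⁻ ω, nOp D F x ω ^ t ∂μ) :=
    Measurable.lintegral_prod_right' (f := fun z : (Fin d → ℝ) × Ω => nOp D F z.1 z.2 ^ t) (hN.pow_const t)
  rcases eq_or_ne (∫⁻ x, (∫⁻ ω, F x ω ^ t ∂μ) ^ θ) 0 with h0 | h0
  · rw [h0, mul_zero, nonpos_iff_eq_zero]
    rw [lintegral_eq_zero_iff (hkm.pow_const θ)] at h0
    have h1 : ∀ᵐ x : Fin d → ℝ, ∀ᵐ ω ∂μ, F x ω = 0 := by
      filter_upwards [h0] with x hx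
      simp only [Pi.zero_apply, ENNReal.rpow_eq_zero_iff_of_pos hθ0] at hx
      rw [lintegral_eq_zero_iff ((measurable_section' hF x).pow_const t)] at hx
      filter_upwards [hx] with ω hω
      simpa only [Pi.zero_apply, ENNReal.rpow_eq_zero_iff_of_pos ht0] using hω
    have hms : MeasurableSet {z : (Fin d → ℝ) × Ω | F z.1 z.2 = 0} := hF (measurableSet_singleton 0)
    rw [Measure.ae_ae_comm (p := fun x ω => F x ω = 0) hms] at h1
    have h2 : ∀ x, ∫⁻ ω, nOp D F x ω ^ t ∂μ = 0 := by
      intro x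
      rw [lintegral_eq_zero_iff ((measurable_section' hN x).pow_const t)]
      filter_upwards [h1] with ω hω
      simp [nOp_zero D F ω hω x, ht0]
    simp [h2, hθ0]
  rcases eq_or_ne (∫⁻ x, (∫⁻ ω, F x ω ^ t ∂μ) ^ θ) ∞ with h1 | h1
  · rw [h1, ENNReal.mul_top (by simp)]
    exact le_top
  have hpw : ∀ x, ((∫⁻ ω, F x ω ^ t ∂μ) ^ (1 / t)) ^ p = (∫⁻ ω, F x ω ^ t ∂μ) ^ θ := by
    intro x
    rw [← ENNReal.rpow_mul]; congr 1; rw [hθ]; ring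
  obtain ⟨u, hu, hle, hun⟩ := hrub (fun x => (∫⁻ ω, F x ω ^ t ∂μ) ^ (1 / t)) (hkm.pow_const _)
    (by simpa only [hpw] using h0) (by simpa only [hpw] using h1)
  simp only [hpw] at hun
  have huδ := hu.rpow hδ0 hδ1
  have hupow : ∀ x, (u x ^ δ) ^ (1 - t) = u x ^ (p - t) := by
    intro x
    rw [← ENNReal.rpow_mul]; congr 1; rw [hδ]; field_simp; ring
  have hmain := tonelli_weight μ D hF t ht0 Cw (fun x => u x ^ (p - t)) (hu.1.pow_const _) (by
    intro G hG
    have := (hw _ huδ G hG).2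
    simpa only [hupow] using this)
  have hk : ∫⁻ x, (∫⁻ ω, F x ω ^ t ∂μ) * u x ^ (p - t) ≤ ∫⁻ x, u x ^ p := by
    apply lintegral_mono_ae
    filter_upwards [hu.2.2.1] with x hx
    have h2 : (∫⁻ ω, F x ω ^ t ∂μ) ≤ u x ^ t := by
      have := ENNReal.rpow_le_rpow (hle x) ht0.le
      rwa [← ENNReal.rpow_mul, one_div_mul_cancel ht0.ne', ENNReal.rpow_one] at this
    calc _ ≤ u x ^ t * u x ^ (p - t) := by gcongr
      _ = u x ^ p := by
        rw [← ENNReal.rpow_add _ _ (hu.2.1 x) hx]; congr 1; ring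
  calc ∫⁻ x, (∫⁻ ω, nOp D F x ω ^ t ∂μ) ^ θ
      = ∫⁻ x, ((∫⁻ ω, nOp D F x ω ^ t ∂μ) * u x ^ (p - t)) ^ θ * (u x ^ p) ^ (1 - θ) := by
        apply lintegral_congr_ae
        filter_upwards [hu.2.2.1] with x hx
        rw [ENNReal.mul_rpow_of_nonneg _ _ hθ0.le, ← ENNReal.rpow_mul, ← ENNReal.rpow_mul, mul_assoc,
          ← ENNReal.rpow_add _ _ (hu.2.1 x) hx]
        have : (p - t) * θ + p * (1 - θ) = 0 := by rw [hθ]; field_simp; ring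
        rw [this, ENNReal.rpow_zero, mul_one]
    _ ≤ (∫⁻ x, (∫⁻ ω, nOp D F x ω ^ t ∂μ) * u x ^ (p - t)) ^ θ * (∫⁻ x, u x ^ p) ^ (1 - θ) :=
        ENNReal.lintegral_mul_norm_pow_le (hSm.mul (hu.1.pow_const _)).aemeasurable
          (hu.1.pow_const _).aemeasurable hθ0.le (by linarith) (by ring)
    _ ≤ (Cw * ∫⁻ x, u x ^ p) ^ θ * (∫⁻ x, u x ^ p) ^ (1 - θ) := by
        gcongr
        exact hmain.trans (by gcongr)
    _ = Cw ^ θ * ∫⁻ x, u x ^ p := by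
        rw [ENNReal.mul_rpow_of_nonneg _ _ hθ0.le, mul_assoc,
          ← ENNReal.rpow_add_of_nonneg _ _ hθ0.le (by linarith)]
        simp
    _ ≤ Cw ^ θ * (Cr * ∫⁻ x, (∫⁻ ω, F x ω ^ t ∂μ) ^ θ) := by gcongr
    _ ≤ _ := by
        rw [← mul_assoc]
        gcongr
        exact le_self_add

lemma fs_high {d : ℕ} (p t : ℝ) (ht : 1 < t) (hpt : t < p) :
    ∃ C : ℝ≥0∞, C ≠ ∞ ∧ ∀ (Ω : Type) [MeasurableSpace Ω] (μ : Measure Ω) [SigmaFinite μ]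
      (D : Finset (Cube d)) (F : (Fin d → ℝ) → Ω → ℝ≥0∞), Measurable (Function.uncurry F) →
      ∫⁻ x, (∫⁻ ω, nOp D F x ω ^ t ∂μ) ^ (p / t) ≤ C * ∫⁻ x, (∫⁻ ω, F x ω ^ t ∂μ) ^ (p / t) := by
  have ht0 : 0 < t := by linarith
  set q := p / t with hq
  have hq1 : 1 < q := by rw [hq, one_lt_div ht0]; exact hpt
  have hq0 : 0 < q := by linarith
  have hconj : q.HolderConjugate (q / (q - 1)) := Real.HolderConjugate.conjExponent hq1
  set q' := q / (q - 1) with hq'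
  have hq'1 : 1 < q' := hconj.symm.lt
  have hq'0 : 0 < q' := by linarith
  obtain ⟨K, Cr, hK, hCr, hrub⟩ := rubio (d := d) q' hq'1
  obtain ⟨Cw, hCw, hw⟩ := weighted_strong (d := d) K hK t ht
  set C' := Cw * Cr ^ (1 / q') with hC'
  have hC't : C' ≠ ∞ := ENNReal.mul_ne_top hCw (ENNReal.rpow_ne_top_of_nonneg (by positivity) hCr)
  refine ⟨C' ^ q, ENNReal.rpow_ne_top_of_nonneg hq0.le hC't, ?_⟩
  intro Ω _ μ _ D F hF
  have hN := measurable_nOp D hF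
  have hkm : Measurable (fun x => ∫⁻ ω, F x ω ^ t ∂μ) :=
    Measurable.lintegral_prod_right' (f := fun z : (Fin d → ℝ) × Ω => F z.1 z.2 ^ t) (hF.pow_const t)
  have hSm : Measurable (fun x => ∫⁻ ω, nOp D F x ω ^ t ∂μ) :=
    Measurable.lintegral_prod_right' (f := fun z : (Fin d → ℝ) × Ω => nOp D F z.1 z.2 ^ t) (hN.pow_const t)
  set S : (Fin d → ℝ) → ℝ≥0∞ := fun x => ∫⁻ ω, nOp D F x ω ^ t ∂μ with hS
  set k : (Fin d → ℝ) → ℝ≥0∞ := fun x => ∫⁻ ω, F x ω ^ t ∂μ with hk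
  let Sn : ℕ → (Fin d → ℝ) → ℝ≥0∞ := fun n => (Metric.ball 0 n).indicator (fun x => min (S x) n)
  have hSnm : ∀ n, Measurable (Sn n) := fun n =>
    (hSm.min measurable_const).indicator Metric.isOpen_ball.measurableSet
  have hSnle : ∀ n x, Sn n x ≤ S x := by
    intro n x
    apply Set.indicator_le'
    · intro y _; exact min_le_left _ _
    · intro y _; exact zero_le
  have hmono : ∀ x, Monotone (fun n => Sn n x) := by
    intro x n m hnm
    have hnm' : (n:ℝ) ≤ m := by exact_mod_cast hnm
    simp only [Sn, Set.indicator]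
    split_ifs with h1 h2
    · gcongr
    · exact absurd (Metric.ball_subset_ball hnm' h1) h2
    · exact zero_le
    · exact le_rfl
  have hsup : ∀ x, ⨆ n, Sn n x = S x := by
    intro x
    apply le_antisymm (iSup_le fun n => hSnle n x)
    apply le_of_forall_lt
    intro b hb
    obtain ⟨n1, hn1⟩ := ENNReal.exists_nat_gt hb.ne_top
    obtain ⟨n2, hn2⟩ := exists_nat_gt (dist x 0)
    refine lt_of_lt_of_le ?_ (le_iSup _ (max n1 n2))
    have hx : x ∈ Metric.ball (0 : Fin d → ℝ) ((max n1 n2 : ℕ) : ℝ) := by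
      rw [Metric.mem_ball]
      refine hn2.trans_le ?_
      exact_mod_cast le_max_right _ _
    simp only [Sn, Set.indicator_of_mem hx]
    apply lt_min hb
    refine hn1.trans_le ?_
    exact_mod_cast le_max_left _ _
  have hbound : ∀ n, ∫⁻ x, Sn n x ^ q ≤ C' ^ q * ∫⁻ x, k x ^ q := by
    intro n
    rcases eq_or_ne (∫⁻ x, Sn n x ^ q) 0 with h0 | h0
    · rw [h0]; exact zero_le
    have hfin : ∫⁻ x, Sn n x ^ q ≠ ∞ := by
      have : ∫⁻ x, Sn n x ^ q ≤ ∫⁻ x in Metric.ball (0 : Fin d → ℝ) n, (n:ℝ≥0∞) ^ q := by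
        rw [← lintegral_indicator Metric.isOpen_ball.measurableSet]
        apply lintegral_mono
        intro x
        simp only [Sn, Set.indicator]
        split_ifs with h1
        · gcongr; exact min_le_right _ _
        · simp [hq0]
      refine ne_top_of_le_ne_top ?_ this
      rw [setLIntegral_const]
      exact ENNReal.mul_ne_top (ENNReal.rpow_ne_top_of_nonneg hq0.le (by simp)) measure_ball_lt_top.ne
    have hpw : ∀ x, (Sn n x ^ (q - 1)) ^ q' = Sn n x ^ q := by
      intro x
      rw [← ENNReal.rpow_mul]; congr 1; rw [hq']
      have : q - 1 ≠ 0 := by linarith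
      field_simp
    obtain ⟨w, hwA, hle, hwn⟩ := hrub (fun x => Sn n x ^ (q - 1)) ((hSnm n).pow_const _)
      (by simpa only [hpw] using h0) (by simpa only [hpw] using hfin)
    simp only [hpw] at hwn
    have hmain := tonelli_weight μ D hF t ht0 Cw w hwA.1 (fun G hG => (hw _ hwA G hG).1)
    have h2 : ∫⁻ x, Sn n x ^ q ≤ C' * (∫⁻ x, k x ^ q) ^ (1 / q) * (∫⁻ x, Sn n x ^ q) ^ (1 / q') := by
      calc ∫⁻ x, Sn n x ^ q ≤ ∫⁻ x, S x * w x := by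
            apply lintegral_mono
            intro x
            calc Sn n x ^ q = Sn n x * Sn n x ^ (q - 1) := by
                  nth_rw 2 [← ENNReal.rpow_one (Sn n x)]
                  rw [← ENNReal.rpow_add_of_nonneg _ _ zero_le_one (by linarith)]
                  congr 1; ring
              _ ≤ S x * w x := by
                  gcongr
                  · exact hSnle n x
                  · exact hle x
        _ ≤ Cw * ∫⁻ x, k x * w x := hmain
        _ ≤ Cw * ((∫⁻ x, k x ^ q) ^ (1 / q) * (∫⁻ x, w x ^ q') ^ (1 / q')) := by
            gcongr
            exact ENNReal.lintegral_mul_le_Lp_mul_Lq volume hconj hkm.aemeasurable hwA.1.aemeasurable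
        _ ≤ Cw * ((∫⁻ x, k x ^ q) ^ (1 / q) * (Cr * ∫⁻ x, Sn n x ^ q) ^ (1 / q')) := by
            gcongr
        _ = _ := by
            rw [ENNReal.mul_rpow_of_nonneg _ _ (by positivity), hC']
            ring
    set I := ∫⁻ x, Sn n x ^ q with hI
    have h3 : I = I ^ (1 / q) * I ^ (1 / q') := by
      rw [← ENNReal.rpow_add _ _ h0 hfin]
      have := hconj.inv_add_inv_eq_one
      simp only [one_div, this, ENNReal.rpow_one]
    have h4 : I ^ (1 / q) ≤ C' * (∫⁻ x, k x ^ q) ^ (1 / q) := by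
      have h2' : I ^ (1 / q) * I ^ (1 / q') ≤
          C' * (∫⁻ x, k x ^ q) ^ (1 / q) * I ^ (1 / q') := by
        rw [← h3]; exact h2
      refine (ENNReal.mul_le_mul_iff_left ?_ ?_).1 h2'
      · intro h; rw [ENNReal.rpow_eq_zero_iff] at h
        rcases h with h | h
        · exact h0 h.1
        · exact hfin h.1
      · exact ENNReal.rpow_ne_top_of_nonneg (by positivity) hfin
    have h5 := ENNReal.rpow_le_rpow h4 hq0.le
    rw [ENNReal.mul_rpow_of_nonneg _ _ hq0.le, ← ENNReal.rpow_mul, ← ENNReal.rpow_mul,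
      one_div_mul_cancel hq0.ne', ENNReal.rpow_one, ENNReal.rpow_one] at h5
    exact h5
  have hS2 : ∀ x, S x ^ q = ⨆ n, Sn n x ^ q := by
    intro x
    rw [← hsup x]
    have := (ENNReal.orderIsoRpow q hq0).map_iSup (fun n => Sn n x)
    simpa only [ENNReal.orderIsoRpow_apply] using this
  show ∫⁻ x, S x ^ q ≤ C' ^ q * ∫⁻ x, k x ^ q
  rw [lintegral_congr hS2, lintegral_iSup (fun n => (hSnm n).pow_const q)]
  · exact iSup_le hbound
  · intro n m hnm x
    exact ENNReal.rpow_le_rpow (hmono x hnm) hq0.le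


lemma eNorm_mono_ae {α : Type*} [MeasurableSpace α] (p : ℝ≥0∞) (μ : Measure α) {F G : α → ℝ≥0∞}
    (h : ∀ᵐ x ∂μ, F x ≤ G x) : eNorm p μ F ≤ eNorm p μ G := by
  unfold eNorm
  split_ifs
  · exact essSup_mono_ae h
  · apply ENNReal.rpow_le_rpow _ (by positivity)
    apply lintegral_mono_ae
    filter_upwards [h] with x hx
    exact ENNReal.rpow_le_rpow hx ENNReal.toReal_nonneg

lemma eNorm_mono {α : Type*} [MeasurableSpace α] (p : ℝ≥0∞) (μ : Measure α) {F G : α → ℝ≥0∞}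
    (h : ∀ x, F x ≤ G x) : eNorm p μ F ≤ eNorm p μ G :=
  eNorm_mono_ae p μ (Filter.Eventually.of_forall h)

lemma eNorm_const_mul {α : Type*} [MeasurableSpace α] (p : ℝ≥0∞) (hp : p ≠ 0) (μ : Measure α)
    (c : ℝ≥0∞) {F : α → ℝ≥0∞} (hF : Measurable F) :
    eNorm p μ (fun x => c * F x) = c * eNorm p μ F := by
  unfold eNorm
  split_ifs with h
  · exact ENNReal.essSup_const_mul
  · have hp0 : 0 < p.toReal := ENNReal.toReal_pos hp h
    simp only [ENNReal.mul_rpow_of_nonneg _ _ hp0.le]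
    rw [lintegral_const_mul _ (hF.pow_const _), ENNReal.mul_rpow_of_nonneg _ _ (by positivity),
      ← ENNReal.rpow_mul, mul_one_div_cancel hp0.ne', ENNReal.rpow_one]

lemma eNorm_rpow {α : Type*} [MeasurableSpace α] (t : ℝ≥0∞) (ht : t ≠ 0) (μ : Measure α)
    (a : ℝ) (ha : 0 < a) (G : α → ℝ≥0∞) :
    eNorm t μ (fun x => G x ^ a) = (eNorm (t * ENNReal.ofReal a) μ G) ^ a := by
  unfold eNorm
  by_cases h : t = ∞
  · have h2 : t * ENNReal.ofReal a = ∞ := by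
      rw [h, ENNReal.top_mul (by simpa using ha)]
    rw [if_pos h, if_pos h2]
    have := OrderIso.essSup_apply (μ := μ) G (ENNReal.orderIsoRpow a ha)
    simpa using this.symm
  · have h2 : t * ENNReal.ofReal a ≠ ∞ := ENNReal.mul_ne_top h (by simp)
    have ht0 : 0 < t.toReal := ENNReal.toReal_pos ht h
    rw [if_neg h, if_neg h2, ENNReal.toReal_mul, ENNReal.toReal_ofReal ha.le, ← ENNReal.rpow_mul]
    simp only [← ENNReal.rpow_mul]
    rw [mul_comm a]
    congr 1
    field_simp

lemma lt_essSup_iff {α : Type*} [MeasurableSpace α] (μ : Measure α) (F : α → ℝ≥0∞) (a : ℝ≥0∞) :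
    a < essSup F μ ↔ μ {x | a < F x} ≠ 0 := by
  rw [← not_le, not_iff_comm, not_ne_iff]
  constructor
  · intro h
    refine essSup_le_of_ae_le a ?_
    have : ∀ᵐ x ∂μ, ¬ (a < F x) := by
      rw [ae_iff]; simpa using h
    filter_upwards [this] with x hx
    exact not_lt.1 hx
  · intro h
    have h1 : ∀ᵐ x ∂μ, ¬ (a < F x) := by
      filter_upwards [ENNReal.ae_le_essSup (μ := μ) F] with x hx
      exact not_lt.2 (hx.trans h)
    rw [ae_iff] at h1
    simpa using h1

lemma measurable_eNorm {d : ℕ} {Ω : Type} [MeasurableSpace Ω] (μ : Measure Ω) [SigmaFinite μ]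
    (t : ℝ≥0∞) {F : (Fin d → ℝ) → Ω → ℝ≥0∞} (hF : Measurable (Function.uncurry F)) :
    Measurable (fun x => eNorm t μ (F x)) := by
  unfold eNorm
  split_ifs with h
  · apply measurable_of_Ioi
    intro a
    have hs : MeasurableSet {z : (Fin d → ℝ) × Ω | a < F z.1 z.2} := hF measurableSet_Ioi
    have := measurable_measure_prodMk_left (ν := μ) hs
    have h2 : (fun x => essSup (F x) μ) ⁻¹' Set.Ioi a =
        (fun x => μ (Prod.mk x ⁻¹' {z : (Fin d → ℝ) × Ω | a < F z.1 z.2})) ⁻¹' {0}ᶜ := by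
      ext x
      exact lt_essSup_iff μ (F x) a
    rw [h2]
    exact this (measurableSet_singleton 0).compl
  · apply Measurable.pow_const
    exact Measurable.lintegral_prod_right' (f := fun z : (Fin d → ℝ) × Ω => F z.1 z.2 ^ t.toReal)
      (hF.pow_const _)

lemma eNorm_eq_zero {α : Type*} [MeasurableSpace α] (p : ℝ≥0∞) (hp : p ≠ 0) (μ : Measure α)
    {F : α → ℝ≥0∞} (hF : Measurable F) : eNorm p μ F = 0 ↔ ∀ᵐ x ∂μ, F x = 0 := by
  unfold eNorm
  split_ifs with h
  · exact ENNReal.essSup_eq_zero_iff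
  · have hp0 : 0 < p.toReal := ENNReal.toReal_pos hp h
    rw [ENNReal.rpow_eq_zero_iff_of_pos (by positivity), lintegral_eq_zero_iff (hF.pow_const _)]
    constructor
    · intro h
      filter_upwards [h] with x hx
      simpa only [Pi.zero_apply, ENNReal.rpow_eq_zero_iff_of_pos hp0] using hx
    · intro h
      filter_upwards [h] with x hx
      simpa only [Pi.zero_apply, ENNReal.rpow_eq_zero_iff_of_pos hp0] using hx

lemma eNorm_prod_le {α ι : Type*} [Fintype ι] [MeasurableSpace α] (μ : Measure α) (t : ι → ℝ≥0∞)
    (ht : ∀ j, t j ≠ 0) (hs : ∑ j, (t j)⁻¹ ≠ 0) (F : ι → α → ℝ≥0∞) (hF : ∀ j, Measurable (F j)) :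
    eNorm (∑ j, (t j)⁻¹)⁻¹ μ (fun x => ∏ j, F j x) ≤ ∏ j, eNorm (t j) μ (F j) := by
  classical
  have hsT : ∑ j, (t j)⁻¹ ≠ ∞ := by
    rw [ENNReal.sum_ne_top]; intro j _; simpa using ht j
  set τ := (∑ j, (t j)⁻¹).toReal with hτ
  have hτ0 : 0 < τ := ENNReal.toReal_pos hs hsT
  set S := Finset.univ.filter (fun j => t j ≠ ∞) with hS
  set c := ∏ j ∈ Finset.univ.filter (fun j => ¬ t j ≠ ∞), eNorm (t j) μ (F j) with hc
  have hsplit : ∀ G : ι → ℝ≥0∞, ∏ j, G j = (∏ j ∈ Finset.univ.filter (fun j => ¬ t j ≠ ∞), G j) *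
      ∏ j ∈ S, G j := by
    intro G
    rw [mul_comm, hS, Finset.prod_filter_mul_prod_filter_not]
  have hbd : ∀ᵐ x ∂μ, ∏ j, F j x ≤ c * ∏ j ∈ S, F j x := by
    have h1 : ∀ᵐ x ∂μ, ∀ j, F j x ≤ essSup (F j) μ := by
      rw [ae_all_iff]; intro j; exact ENNReal.ae_le_essSup _
    filter_upwards [h1] with x hx
    rw [hsplit]
    gcongr
    apply Finset.prod_le_prod' 
    intro j hj
    have hj' : t j = ∞ := by simpa using hj
    rw [eNorm, if_pos hj']
    exact hx j
  have hTne : (∑ j, (t j)⁻¹)⁻¹ ≠ ∞ := by simpa using hs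
  have hTr : ((∑ j, (t j)⁻¹)⁻¹).toReal = 1 / τ := by rw [ENNReal.toReal_inv, one_div]
  have htr : ∀ j ∈ S, 0 < (t j).toReal := by
    intro j hj
    exact ENNReal.toReal_pos (ht j) (by simpa [hS] using hj)
  refine (eNorm_mono_ae _ μ hbd).trans ?_
  rw [eNorm_const_mul _ (by simpa using hsT) μ c (Finset.measurable_prod _ (fun j _ => hF j)), hsplit]
  refine mul_le_mul_right ?_ _
  rw [eNorm, if_neg hTne, hTr]
  have hw : ∑ j ∈ S, 1 / ((t j).toReal * τ) = 1 := by
    have h1 : τ = ∑ j ∈ S, 1 / (t j).toReal := by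
      rw [hτ, ENNReal.toReal_sum (by intro j _; simpa using ht j), hS, Finset.sum_filter]
      apply Finset.sum_congr rfl
      intro j _
      split_ifs with h
      · rw [ENNReal.toReal_inv, one_div]
      · have : t j = ∞ := by simpa using h
        simp [this]
    have h2 : ∑ j ∈ S, 1 / ((t j).toReal * τ) = (∑ j ∈ S, 1 / (t j).toReal) / τ := by
      rw [Finset.sum_div]
      apply Finset.sum_congr rfl
      intro j _
      rw [div_div]
    rw [h2, ← h1, div_self hτ0.ne']
  have hint : ∫⁻ x, (∏ j ∈ S, F j x) ^ (1 / τ) ∂μ ≤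
      ∏ j ∈ S, (∫⁻ x, F j x ^ (t j).toReal ∂μ) ^ (1 / ((t j).toReal * τ)) := by
    refine le_trans (le_of_eq ?_) (ENNReal.lintegral_prod_norm_pow_le S
      (f := fun j x => F j x ^ (t j).toReal) (fun j _ => ((hF j).pow_const _).aemeasurable) hw ?_)
    · apply lintegral_congr
      intro x
      rw [← ENNReal.prod_rpow_of_nonneg (by positivity)]
      apply Finset.prod_congr rfl
      intro j hj
      have := htr j hj
      rw [← ENNReal.rpow_mul]; congr 1; field_simp
    · intro j hj
      have := htr j hj
      positivity
  rw [one_div_one_div]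
  refine (ENNReal.rpow_le_rpow hint hτ0.le).trans (le_of_eq ?_)
  rw [← ENNReal.prod_rpow_of_nonneg hτ0.le]
  apply Finset.prod_congr rfl
  intro j hj
  have := htr j hj
  have h2 : t j ≠ ∞ := by simpa [hS] using hj
  rw [← ENNReal.rpow_mul, eNorm, if_neg h2]; congr 1; field_simp

lemma mixed_zero {d : ℕ} {Ω : Type} [MeasurableSpace Ω] (μ : Measure Ω) [SigmaFinite μ]
    (p t : ℝ≥0∞) (hp : p ≠ 0) (ht : t ≠ 0) {F : (Fin d → ℝ) → Ω → ℝ≥0∞}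
    (hF : Measurable (Function.uncurry F)) (h : eNorm p volume (fun x => eNorm t μ (F x)) = 0) :
    ∀ᵐ ω ∂μ, ∀ᵐ x, F x ω = 0 := by
  rw [eNorm_eq_zero p hp _ (measurable_eNorm μ t hF)] at h
  have h1 : ∀ᵐ x : Fin d → ℝ, ∀ᵐ ω ∂μ, F x ω = 0 := by
    filter_upwards [h] with x hx
    rwa [eNorm_eq_zero t ht _ (measurable_section' hF x)] at hx
  have hms : MeasurableSet {z : (Fin d → ℝ) × Ω | F z.1 z.2 = 0} := hF (measurableSet_singleton 0)
  rwa [Measure.ae_ae_comm (p := fun x ω => F x ω = 0) hms] at h1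


lemma fs_fin {d : ℕ} (p t : ℝ) (hp : 1 < p) (ht : 1 < t) :
    ∃ C : ℝ≥0∞, C ≠ ∞ ∧ ∀ (Ω : Type) [MeasurableSpace Ω] (μ : Measure Ω) [SigmaFinite μ]
      (D : Finset (Cube d)) (F : (Fin d → ℝ) → Ω → ℝ≥0∞), Measurable (Function.uncurry F) →
      ∫⁻ x, (∫⁻ ω, nOp D F x ω ^ t ∂μ) ^ (p / t) ≤ C * ∫⁻ x, (∫⁻ ω, F x ω ^ t ∂μ) ^ (p / t) := by
  rcases le_or_gt p t with h | h
  · exact fs_low p t hp h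
  · exact fs_high p t ht h

lemma fs_one {d : ℕ} (p t : ℝ≥0∞) (hp : 1 < p) (hpt : p ≠ ∞) (ht : 1 < t) :
    ∃ C : ℝ≥0∞, C ≠ ∞ ∧ ∀ (Ω : Type) [MeasurableSpace Ω] (μ : Measure Ω) [SigmaFinite μ]
      (D : Finset (Cube d)) (F : (Fin d → ℝ) → Ω → ℝ≥0∞), Measurable (Function.uncurry F) →
      eNorm p volume (fun x => eNorm t μ (nOp D F x)) ≤
        C * eNorm p volume (fun x => eNorm t μ (F x)) := by
  have hp1 : 1 < p.toReal := by
    rw [← ENNReal.toReal_one]; exact (ENNReal.toReal_lt_toReal (by simp) hpt).2 hp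
  have hp0 : 0 < p.toReal := by linarith
  have key : ∀ C A B : ℝ≥0∞, A ≤ C * B →
      A ^ (1 / p.toReal) ≤ C ^ (1 / p.toReal) * B ^ (1 / p.toReal) := by
    intro C A B h
    rw [← ENNReal.mul_rpow_of_nonneg _ _ (by positivity)]
    exact ENNReal.rpow_le_rpow h (by positivity)
  by_cases htt : t = ∞
  · obtain ⟨C, hC, hw⟩ := weighted_strong (d := d) 1 (by simp) p.toReal hp1
    refine ⟨C ^ (1 / p.toReal), ENNReal.rpow_ne_top_of_nonneg (by positivity) hC, ?_⟩
    intro Ω _ μ _ D F hF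
    have hm := measurable_eNorm μ t hF
    have h1 := (hw _ IsA1.one _ hm).1
    simp only [mul_one] at h1
    have h2 : ∀ x, eNorm t μ (nOp D F x) ≤ mxOp volume (fun x => eNorm t μ (F x)) x := by
      intro x
      have h3 : ∀ᵐ y : Fin d → ℝ, ∀ᵐ ω ∂μ, F y ω ≤ eNorm t μ (F y) := by
        refine Filter.Eventually.of_forall fun y => ?_
        rw [eNorm, if_pos htt]
        exact ENNReal.ae_le_essSup _
      have hms : MeasurableSet {z : (Fin d → ℝ) × Ω | F z.1 z.2 ≤ eNorm t μ (F z.1)} :=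
        measurableSet_le hF (hm.comp measurable_fst)
      rw [Measure.ae_ae_comm (p := fun y ω => F y ω ≤ eNorm t μ (F y)) hms] at h3
      rw [eNorm, if_pos htt]
      refine essSup_le_of_ae_le _ ?_
      filter_upwards [h3] with ω hω
      refine iSup_le fun Q => iSup_le fun _ => iSup_le fun hx => ?_
      refine le_trans ?_ (le_mxOp volume _ hx)
      refine ENNReal.div_le_div_right ?_ _
      exact lintegral_mono_ae (ae_restrict_of_ae hω)
    rw [eNorm, if_neg hpt, eNorm, if_neg hpt]
    apply key
    refine le_trans ?_ h1
    apply lintegral_mono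
    intro x
    exact ENNReal.rpow_le_rpow (h2 x) hp0.le
  · have ht1 : 1 < t.toReal := by
      rw [← ENNReal.toReal_one]; exact (ENNReal.toReal_lt_toReal (by simp) htt).2 ht
    obtain ⟨C, hC, hw⟩ := fs_fin (d := d) p.toReal t.toReal hp1 ht1
    refine ⟨C ^ (1 / p.toReal), ENNReal.rpow_ne_top_of_nonneg (by positivity) hC, ?_⟩
    intro Ω _ μ _ D F hF
    have := hw Ω μ D F hF
    rw [eNorm, if_neg hpt, eNorm, if_neg hpt]
    apply key
    simp only [eNorm, if_neg htt, ← ENNReal.rpow_mul]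
    rwa [one_div_mul_eq_div]

/-- power averages over the ball of a cube -/
def av {d : ℕ} (r : ℝ) (G : (Fin d → ℝ) → ℝ≥0∞) (Q : Cube d) : ℝ≥0∞ :=
  ((∫⁻ y in bl Q, G y ^ r) / volume (bl Q)) ^ (1 / r)

/-- lattice maximal operator, exponent `r` -/
def nOpR {d : ℕ} {Ω : Type} (r : ℝ) (D : Finset (Cube d)) (F : (Fin d → ℝ) → Ω → ℝ≥0∞)
    (x : Fin d → ℝ) (ω : Ω) : ℝ≥0∞ :=
  ⨆ Q ∈ D, ⨆ (_ : x ∈ bl Q), av r (fun y => F y ω) Q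

lemma measurable_av {d : ℕ} {Ω : Type} [MeasurableSpace Ω] (r : ℝ)
    {F : (Fin d → ℝ) → Ω → ℝ≥0∞} (hF : Measurable (Function.uncurry F)) (Q : Cube d) :
    Measurable (fun ω => av r (fun y => F y ω) Q) := by
  apply Measurable.pow_const
  apply Measurable.div_const
  exact Measurable.lintegral_prod_left' (f := fun z : (Fin d → ℝ) × Ω => F z.1 z.2 ^ r) (hF.pow_const _)

lemma measurable_nOpR {d : ℕ} {Ω : Type} [MeasurableSpace Ω] (r : ℝ) (D : Finset (Cube d))
    {F : (Fin d → ℝ) → Ω → ℝ≥0∞} (hF : Measurable (Function.uncurry F)) :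
    Measurable (Function.uncurry (nOpR r D F)) := by
  apply measurable_sup_fam
  exact measurable_av r hF

lemma nOpR_le {d : ℕ} {Ω : Type} (r : ℝ) (hr : 0 < r) (D : Finset (Cube d))
    (F : (Fin d → ℝ) → Ω → ℝ≥0∞) (x : Fin d → ℝ) (ω : Ω) :
    nOpR r D F x ω ≤ (nOp D (fun y ω => F y ω ^ r) x ω) ^ (1 / r) := by
  refine iSup_le fun Q => iSup_le fun hQ => iSup_le fun hx => ?_
  apply ENNReal.rpow_le_rpow _ (by positivity)
  exact le_trans (le_iSup (fun _ : x ∈ bl Q => (∫⁻ y in bl Q, F y ω ^ r) / volume (bl Q)) hx)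
    (le_iSup₂ (f := fun Q (_ : Q ∈ D) => ⨆ (_ : x ∈ bl Q), (∫⁻ y in bl Q, F y ω ^ r) / volume (bl Q)) Q hQ)

lemma mixed_rpow {d : ℕ} {Ω : Type} [MeasurableSpace Ω] (μ : Measure Ω) (p t : ℝ≥0∞)
    (hp : p ≠ 0) (ht : t ≠ 0) (a : ℝ) (ha : 0 < a) (G : (Fin d → ℝ) → Ω → ℝ≥0∞) :
    eNorm p volume (fun x => eNorm t μ (fun ω => G x ω ^ a)) =
      (eNorm (p * ENNReal.ofReal a) volume (fun x => eNorm (t * ENNReal.ofReal a) μ (G x))) ^ a := by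
  simp only [eNorm_rpow t ht μ a ha]
  rw [eNorm_rpow p hp _ a ha]

lemma fs_gen {d : ℕ} (r : ℝ) (hr : 0 < r) (p t : ℝ≥0∞) (hp : ENNReal.ofReal r < p) (hpt : p ≠ ∞)
    (ht : ENNReal.ofReal r < t) :
    ∃ C : ℝ≥0∞, C ≠ ∞ ∧ ∀ (Ω : Type) [MeasurableSpace Ω] (μ : Measure Ω) [SigmaFinite μ]
      (D : Finset (Cube d)) (F : (Fin d → ℝ) → Ω → ℝ≥0∞), Measurable (Function.uncurry F) →
      eNorm p volume (fun x => eNorm t μ (nOpR r D F x)) ≤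
        C * eNorm p volume (fun x => eNorm t μ (F x)) := by
  set R := ENNReal.ofReal r with hR
  have hR0 : R ≠ 0 := by simpa [hR] using hr
  have hRt : R ≠ ∞ := by simp [hR]
  have hinv : ENNReal.ofReal (1 / r) = R⁻¹ := by rw [one_div, ENNReal.ofReal_inv_of_pos hr]
  have hp1 : 1 < p / R := by
    rw [ENNReal.lt_div_iff_mul_lt (Or.inl hR0) (Or.inl hRt), one_mul]; exact hp
  have ht1 : 1 < t / R := by
    rw [ENNReal.lt_div_iff_mul_lt (Or.inl hR0) (Or.inl hRt), one_mul]; exact ht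
  obtain ⟨C, hC, h⟩ := fs_one (d := d) (p / R) (t / R) hp1 (ENNReal.div_ne_top hpt hR0) ht1
  refine ⟨C ^ (1 / r), ENNReal.rpow_ne_top_of_nonneg (by positivity) hC, ?_⟩
  intro Ω _ μ _ D F hF
  have h1 := h Ω μ D (fun y ω => F y ω ^ r) (hF.pow_const r)
  have hp0 : p ≠ 0 := (bot_lt_of_lt hp).ne'
  have ht0 : t ≠ 0 := (bot_lt_of_lt ht).ne'
  rw [mixed_rpow μ (p / R) (t / R) (by positivity) (by positivity) r hr F,
    ENNReal.div_mul_cancel hR0 hRt, ENNReal.div_mul_cancel hR0 hRt] at h1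
  calc eNorm p volume (fun x => eNorm t μ (nOpR r D F x))
      ≤ eNorm p volume (fun x => eNorm t μ
          (fun ω => (nOp D (fun y ω => F y ω ^ r) x ω) ^ (1 / r))) := by
        apply eNorm_mono; intro x; apply eNorm_mono; intro ω
        exact nOpR_le r hr D F x ω
    _ = (eNorm (p / R) volume (fun x => eNorm (t / R) μ
          (nOp D (fun y ω => F y ω ^ r) x))) ^ (1 / r) := by
        rw [mixed_rpow μ p t hp0 ht0 (1 / r) (by positivity), hinv]
        rfl
    _ ≤ (C * eNorm p volume (fun x => eNorm t μ (F x)) ^ r) ^ (1 / r) := by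
        gcongr
    _ = _ := by
        rw [ENNReal.mul_rpow_of_nonneg _ _ (by positivity), ← ENNReal.rpow_mul,
          mul_one_div_cancel hr.ne', ENNReal.rpow_one]


/-- multilinear lattice maximal operator over balls -/
def tOp {d : ℕ} {ι : Type} [Fintype ι] {Ω : Type} (r : ι → ℝ) (D : Finset (Cube d))
    (F : ι → (Fin d → ℝ) → Ω → ℝ≥0∞) (x : Fin d → ℝ) (ω : Ω) : ℝ≥0∞ :=
  ⨆ Q ∈ D, ⨆ (_ : x ∈ bl Q), ∏ j, av (r j) (fun y => F j y ω) Q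

lemma measurable_tOp {d : ℕ} {ι : Type} [Fintype ι] {Ω : Type} [MeasurableSpace Ω] (r : ι → ℝ)
    (D : Finset (Cube d)) {F : ι → (Fin d → ℝ) → Ω → ℝ≥0∞}
    (hF : ∀ j, Measurable (Function.uncurry (F j))) :
    Measurable (Function.uncurry (tOp r D F)) := by
  apply measurable_sup_fam D (fun Q ω => ∏ j, av (r j) (fun y => F j y ω) Q)
  intro Q
  exact Finset.measurable_prod _ (fun j _ => measurable_av (r j) (hF j) Q)

lemma tOp_le {d : ℕ} {ι : Type} [Fintype ι] {Ω : Type} (r : ι → ℝ) (D : Finset (Cube d))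
    (F : ι → (Fin d → ℝ) → Ω → ℝ≥0∞) (x : Fin d → ℝ) (ω : Ω) :
    tOp r D F x ω ≤ ∏ j, nOpR (r j) D (F j) x ω := by
  refine iSup_le fun Q => iSup_le fun hQ => iSup_le fun hx => ?_
  apply Finset.prod_le_prod'
  intro j _
  exact le_trans (le_iSup (fun _ : x ∈ bl Q => av (r j) (fun y => F j y ω) Q) hx)
    (le_iSup₂ (f := fun Q (_ : Q ∈ D) => ⨆ (_ : x ∈ bl Q), av (r j) (fun y => F j y ω) Q) Q hQ)

lemma core {d : ℕ} {ι : Type} [Fintype ι] (r : ι → ℝ) (hr : ∀ j, 0 < r j) (p t : ι → ℝ≥0∞)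
    (hp : ∀ j, ENNReal.ofReal (r j) < p j) (hpt : ∀ j, p j ≠ ∞)
    (ht : ∀ j, ENNReal.ofReal (r j) < t j) (hts : ∑ j, (t j)⁻¹ = 1) (hps : ∑ j, (p j)⁻¹ ≠ 0) :
    ∃ C : ℝ≥0∞, C ≠ ∞ ∧ ∀ (Ω : Type) [MeasurableSpace Ω] (μ : Measure Ω) [SigmaFinite μ]
      (D : Finset (Cube d)) (F : ι → (Fin d → ℝ) → Ω → ℝ≥0∞),
      (∀ j, Measurable (Function.uncurry (F j))) →
      eNorm (∑ j, (p j)⁻¹)⁻¹ volume (fun x => eNorm 1 μ (tOp r D F x)) ≤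
        C * ∏ j, eNorm (p j) volume (fun x => eNorm (t j) μ (F j x)) := by
  choose C hC h using fun j => fs_gen (d := d) (r j) (hr j) (p j) (t j) (hp j) (hpt j) (ht j)
  have hp0 : ∀ j, p j ≠ 0 := fun j => (bot_lt_of_lt (hp j)).ne'
  have ht0 : ∀ j, t j ≠ 0 := fun j => (bot_lt_of_lt (ht j)).ne'
  refine ⟨∏ j, C j, ENNReal.prod_ne_top (fun j _ => hC j), ?_⟩
  intro Ω _ μ _ D F hF
  have hN := fun j => measurable_nOpR (r j) D (hF j)
  have h1 : ∀ x, eNorm 1 μ (tOp r D F x) ≤ ∏ j, eNorm (t j) μ (nOpR (r j) D (F j) x) := by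
    intro x
    have := eNorm_prod_le μ t ht0 (by rw [hts]; exact one_ne_zero)
      (fun j => nOpR (r j) D (F j) x) (fun j => measurable_section' (hN j) x)
    rw [hts, inv_one] at this
    exact (eNorm_mono 1 μ (fun ω => tOp_le r D F x ω)).trans this
  refine (eNorm_mono _ volume h1).trans ?_
  refine (eNorm_prod_le volume p hp0 hps _ (fun j => measurable_eNorm μ (t j) (hN j))).trans ?_
  rw [← Finset.prod_mul_distrib]
  apply Finset.prod_le_prod'
  intro j _
  exact h j Ω μ D (F j) (hF j)

lemma vol_bl_ne_zero {d : ℕ} (Q : Cube d) : volume (bl Q) ≠ 0 := vol_ball_ne_zero _ _ Q.side_pos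

lemma vol_bl_ne_top {d : ℕ} (Q : Cube d) : volume (bl Q) ≠ ∞ := vol_ball_ne_top _ _

lemma av_le_other {d : ℕ} {K : ℝ≥0∞} {v : (Fin d → ℝ) → ℝ≥0∞} (hv : IsA1 K v) (hK : K ≠ ∞)
    (r : ℝ) (hr : 0 < r) (e : ℝ) (he : 0 ≤ e) {G : (Fin d → ℝ) → ℝ≥0∞} (hG : Measurable G)
    (Q : Cube d) :
    av r G Q ≤ K ^ e * ((∫⁻ y in bl Q, v y) / volume (bl Q)) ^ (-e) *
      av r (fun y => G y * v y ^ e) Q := by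
  set a := (∫⁻ y in bl Q, v y) / volume (bl Q) with ha
  have ha0 : a ≠ 0 := (ENNReal.div_pos (hv.int_ne_zero _ _ Q.side_pos) (vol_bl_ne_top Q)).ne'
  have hat : a ≠ ∞ := ENNReal.div_ne_top (hv.int_ne_top hK _ _ Q.side_pos) (vol_bl_ne_zero Q)
  have haK : ∀ y ∈ bl Q, a ≤ K * v y := by
    intro y hy
    have := hv.2.2.2 _ _ y hy
    rw [ha]
    apply ENNReal.div_le_of_le_mul
    calc _ ≤ _ := this
      _ = _ := by rw [bl]; ring
  have hKe : K ^ e ≠ ∞ := ENNReal.rpow_ne_top_of_nonneg he hK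
  have hconst : ∀ (c : ℝ≥0∞) (H : (Fin d → ℝ) → ℝ≥0∞), Measurable H →
      av r (fun y => c * H y) Q = c * av r H Q := by
    intro c H hH
    unfold av
    simp only [ENNReal.mul_rpow_of_nonneg _ _ hr.le]
    rw [lintegral_const_mul _ (hH.pow_const _), mul_div_assoc,
      ENNReal.mul_rpow_of_nonneg _ _ (by positivity),
      ← ENNReal.rpow_mul, mul_one_div_cancel hr.ne', ENNReal.rpow_one]
  have h1 : a ^ e * av r G Q ≤ K ^ e * av r (fun y => G y * v y ^ e) Q := by
    rw [← hconst _ _ hG, ← hconst _ (fun y => G y * v y ^ e) (hG.mul (hv.1.pow_const _))]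
    apply ENNReal.rpow_le_rpow _ (by positivity)
    refine ENNReal.div_le_div_right ?_ _
    apply setLIntegral_mono' (measurableSet_bl Q)
    intro y hy
    apply ENNReal.rpow_le_rpow _ hr.le
    calc a ^ e * G y ≤ (K * v y) ^ e * G y := by
          gcongr; exact haK y hy
      _ = _ := by rw [ENNReal.mul_rpow_of_nonneg _ _ he]; ring
  calc av r G Q = a ^ (-e) * (a ^ e * av r G Q) := by
        rw [← mul_assoc, ← ENNReal.rpow_add _ _ ha0 hat]; simp
    _ ≤ a ^ (-e) * (K ^ e * av r (fun y => G y * v y ^ e) Q) := by gcongr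
    _ = _ := by ring

lemma av_le_main {d : ℕ} {K : ℝ≥0∞} {v : (Fin d → ℝ) → ℝ≥0∞} (hv : IsA1 K v)
    (r rr : ℝ) (hr : 0 < r) (hrr : r < rr) {G : (Fin d → ℝ) → ℝ≥0∞} (hG : Measurable G)
    (Q : Cube d) :
    av r G Q ≤ ((∫⁻ y in bl Q, v y) / volume (bl Q)) ^ (-(1 / rr - 1 / r)) *
      av rr (fun y => G y * v y ^ (1 / rr - 1 / r)) Q := by
  have hrr0 : 0 < rr := hr.trans hrr
  set η := 1 / rr - 1 / r with hη
  have hη0 : η < 0 := by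
    rw [hη]; have := one_div_lt_one_div_of_lt hr hrr; linarith
  have hth : r / rr ≤ 1 := by rw [div_le_one hrr0]; exact hrr.le
  let ν : Measure (Fin d → ℝ) := (volume (bl Q))⁻¹ • volume.restrict (bl Q)
  have hν : ∀ f : (Fin d → ℝ) → ℝ≥0∞, (∫⁻ y in bl Q, f y) / volume (bl Q) = ∫⁻ y, f y ∂ν := by
    intro f
    rw [lintegral_smul_measure, smul_eq_mul, ENNReal.div_eq_inv_mul]
  have hae : ∀ᵐ y ∂ν, v y ≠ ∞ := Measure.ae_smul_measure (ae_restrict_of_ae hv.2.2.1) _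
  unfold av
  simp only [hν]
  have h1 : ∫⁻ y, G y ^ r ∂ν ≤
      (∫⁻ y, (G y * v y ^ η) ^ rr ∂ν) ^ (r / rr) * (∫⁻ y, v y ∂ν) ^ (1 - r / rr) := by
    refine le_trans (le_of_eq ?_) (ENNReal.lintegral_mul_norm_pow_le
      (f := fun y => (G y * v y ^ η) ^ rr) (((hG.mul (hv.1.pow_const _)).pow_const _)).aemeasurable hv.1.aemeasurable
      (by positivity) (by linarith) (by ring))
    apply lintegral_congr_ae
    filter_upwards [hae] with y hy
    rw [← ENNReal.rpow_mul, mul_div_cancel₀ _ hrr0.ne', ENNReal.mul_rpow_of_nonneg _ _ hr.le,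
      ← ENNReal.rpow_mul, mul_assoc, ← ENNReal.rpow_add _ _ (hv.2.1 y) hy]
    have : η * r + (1 - r / rr) = 0 := by rw [hη]; field_simp; ring
    rw [this, ENNReal.rpow_zero, mul_one]
  refine (ENNReal.rpow_le_rpow h1 (by positivity : 0 ≤ 1 / r)).trans (le_of_eq ?_)
  rw [ENNReal.mul_rpow_of_nonneg _ _ (by positivity), ← ENNReal.rpow_mul, ← ENNReal.rpow_mul, mul_comm]
  congr 2
  · rw [hη]; field_simp; ring
  · field_simp

lemma params {ι : Type} [Fintype ι] [DecidableEq ι] [Nontrivial ι] (r b τ : ι → ℝ) (hr : ∀ j, 0 < r j)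
    (hb0 : ∀ j, 0 ≤ b j) (hb : ∀ j, b j < 1 / r j) (hτ : ∀ j, τ j < 1 / r j) (i : ι) (hbi : 0 < b i) :
    ∃ (rr e : ι → ℝ) (q : ℝ), 1 < q ∧ (∀ j, 0 < rr j) ∧ r i < rr i ∧ e i = 1 / rr i - 1 / r i ∧
      (∀ j, j ≠ i → rr j = r j ∧ 0 < e j) ∧ ∑ j, e j = 0 ∧
      (∀ j, 0 < b j + e j / q ∧ b j + e j / q < 1 / rr j) ∧ ∀ j, τ j < 1 / rr j := by
  obtain ⟨σ, hσ1, hσ2⟩ := exists_between (max_lt (hb i) (hτ i))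
  have hσb : b i < σ := (le_max_left _ _).trans_lt hσ1
  have hστ : τ i < σ := (le_max_right _ _).trans_lt hσ1
  have hσ0 : 0 < σ := hbi.trans hσb
  set η := 1 / r i - σ with hη
  have hη0 : 0 < η := by rw [hη]; linarith
  set L : ℝ := (Fintype.card ι : ℝ) - 1 with hL
  have hL0 : 0 < L := by
    have : (1:ℝ) < Fintype.card ι := by exact_mod_cast Fintype.one_lt_card
    rw [hL]; linarith
  let rr : ι → ℝ := Function.update r i (1 / σ)
  let e : ι → ℝ := Function.update (fun _ => η / L) i (-η)
  have hrri : rr i = 1 / σ := by simp [rr]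
  have hrrj : ∀ j, j ≠ i → rr j = r j := fun j hj => by simp [rr, hj]
  have hei : e i = -η := by simp [e]
  have hej : ∀ j, j ≠ i → e j = η / L := fun j hj => by simp [e, hj]
  have hrr1 : ∀ j, b j < 1 / rr j := by
    intro j
    by_cases hj : j = i
    · subst hj; rw [hrri, one_div_one_div]; exact hσb
    · rw [hrrj j hj]; exact hb j
  have hlim : ∀ j, Filter.Tendsto (fun q : ℝ => b j + e j / q) Filter.atTop (nhds (b j)) := by
    intro j
    have := (tendsto_const_nhds (x := b j)).add
      ((tendsto_const_nhds (x := e j)).div_atTop Filter.tendsto_id)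
    simpa using this
  have hev : ∀ᶠ q : ℝ in Filter.atTop, 1 < q ∧ ∀ j, 0 < b j + e j / q ∧ b j + e j / q < 1 / rr j := by
    refine (Filter.eventually_gt_atTop 1).and ?_
    rw [Filter.eventually_all]
    intro j
    refine Filter.Eventually.and ?_ ((hlim j).eventually_lt_const (hrr1 j))
    by_cases hj : j = i
    · subst hj; exact (hlim j).eventually_const_lt hbi
    · filter_upwards [Filter.eventually_gt_atTop 1] with q hq
      rw [hej j hj]
      have := hb0 j
      have : 0 < η / L / q := by positivity
      linarith
  obtain ⟨q, hq1, hq⟩ := hev.exists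
  refine ⟨rr, e, q, hq1, ?_, ?_, ?_, ?_, ?_, hq, ?_⟩
  · intro j
    by_cases hj : j = i
    · subst hj; rw [hrri]; positivity
    · rw [hrrj j hj]; exact hr j
  · rw [hrri, lt_one_div (hr i) hσ0]; exact hσ2
  · rw [hei, hrri, one_div_one_div, hη]; ring
  · intro j hj
    refine ⟨hrrj j hj, ?_⟩
    rw [hej j hj]; positivity
  · rw [← Finset.add_sum_erase _ _ (Finset.mem_univ i), hei,
      Finset.sum_congr rfl (fun j hj => hej j (Finset.ne_of_mem_erase hj)), Finset.sum_const,
      Finset.card_erase_of_mem (Finset.mem_univ i), nsmul_eq_mul, Finset.card_univ,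
      Nat.cast_sub Fintype.card_pos, Nat.cast_one, ← hL]
    field_simp
    ring
  · intro j
    by_cases hj : j = i
    · subst hj; rw [hrri, one_div_one_div]; exact hστ
    · rw [hrrj j hj]; exact hτ j


lemma norm_other {d : ℕ} {v h : (Fin d → ℝ) → ℝ≥0∞} (hv : Measurable v) (hh : Measurable h)
    (q e : ℝ) (hq : 0 < q) (he : 0 < e) (p pp : ℝ≥0∞) (hp : p ≠ 0)
    (hpp : pp⁻¹ = p⁻¹ + ENNReal.ofReal (e / q)) :
    eNorm pp volume (fun x => h x * v x ^ e) ≤ eNorm p volume h * (∫⁻ x, v x ^ q) ^ (e / q) := by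
  have hqe : 0 < q / e := by positivity
  have hinv : (ENNReal.ofReal (q / e))⁻¹ = ENNReal.ofReal (e / q) := by
    rw [← ENNReal.ofReal_inv_of_pos hqe, inv_div]
  have h1 := eNorm_prod_le (ι := Bool) (volume : Measure (Fin d → ℝ))
    (fun c => cond c p (ENNReal.ofReal (q / e)))
    (by intro j; cases j <;> simp [hp, hqe])
    (by
      rw [Fintype.sum_bool]
      simp only [cond_true, cond_false, hinv]
      have : ENNReal.ofReal (e / q) ≠ 0 := by
        simp only [ne_eq, ENNReal.ofReal_eq_zero, not_le]; positivity
      simp [this])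
    (fun c => cond c h (fun x => v x ^ e))
    (by intro j; cases j; exacts [hv.pow_const e, hh])
  simp only [Fintype.sum_bool, Fintype.prod_bool, cond_true, cond_false, hinv, ← hpp, inv_inv] at h1
  refine h1.trans (le_of_eq ?_)
  congr 1
  rw [eNorm, if_neg (by simp), ENNReal.toReal_ofReal hqe.le, one_div_div]
  simp only [← ENNReal.rpow_mul, mul_div_cancel₀ q he.ne']

lemma norm_main {d : ℕ} {v h : (Fin d → ℝ) → ℝ≥0∞} 
    (hv0 : ∀ x, v x ≠ 0) (hvt : ∀ᵐ x, v x ≠ ∞)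
    (q b e : ℝ) (hq : 0 < q) (hs : 0 < b + e / q) (hle : ∀ x, h x ≤ v x ^ (q * b)) :
    eNorm (ENNReal.ofReal (b + e / q))⁻¹ volume (fun x => h x * v x ^ e) ≤
      (∫⁻ x, v x ^ q) ^ (b + e / q) := by
  have h1 : ∀ᵐ x, h x * v x ^ e ≤ v x ^ (q * b + e) := by
    filter_upwards [hvt] with x hx
    rw [ENNReal.rpow_add _ _ (hv0 x) hx]
    gcongr
    exact hle x
  refine (eNorm_mono_ae _ _ h1).trans (le_of_eq ?_)
  rw [eNorm, if_neg (by simpa using hs), ENNReal.toReal_inv, ENNReal.toReal_ofReal hs.le, one_div, inv_inv]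
  congr 2
  ext x
  rw [← ENNReal.rpow_mul]
  congr 1
  have : q * b + e = q * (b + e / q) := by field_simp
  rw [this, mul_inv_cancel_right₀ hs.ne']

lemma tOp_eq_zero {d : ℕ} {ι : Type} [Fintype ι] {Ω : Type} (r : ι → ℝ) (hr : ∀ j, 0 < r j)
    (D : Finset (Cube d)) (F : ι → (Fin d → ℝ) → Ω → ℝ≥0∞) (ω : Ω) (j : ι)
    (h : ∀ᵐ y, F j y ω = 0) (x : Fin d → ℝ) : tOp r D F x ω = 0 := by
  rw [← nonpos_iff_eq_zero]
  refine iSup_le fun Q => iSup_le fun _ => iSup_le fun hx => ?_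
  rw [nonpos_iff_eq_zero]
  apply Finset.prod_eq_zero (Finset.mem_univ j)
  have : ∫⁻ y in bl Q, F j y ω ^ r j = 0 := by
    rw [← lintegral_zero (μ := volume.restrict (bl Q))]
    apply lintegral_congr_ae
    filter_upwards [ae_restrict_of_ae h] with y hy
    simp [hy, hr j]
  simp [av, this, hr j]

lemma prod_rpow_sum {ι : Type} [Fintype ι] (a : ℝ≥0∞) (h0 : a ≠ 0) (ht : a ≠ ∞) (e : ι → ℝ) :
    ∏ j, a ^ e j = a ^ (∑ j, e j) := by
  classical
  induction (Finset.univ : Finset ι) using Finset.induction_on with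
  | empty => simp
  | insert i s hi ih =>
    rw [Finset.prod_insert hi, Finset.sum_insert hi, ih, ENNReal.rpow_add _ _ h0 ht]

lemma tOp_weight {d : ℕ} {ι : Type} [Fintype ι] {Ω : Type} [MeasurableSpace Ω]
    (r rr e : ι → ℝ) (hr : ∀ j, 0 < r j) (i : ι)
    (hri : r i < rr i) (hei : e i = 1 / rr i - 1 / r i)
    (hj : ∀ j, j ≠ i → rr j = r j ∧ 0 < e j) (hsum : ∑ j, e j = 0)
    {K : ℝ≥0∞} {v : (Fin d → ℝ) → ℝ≥0∞} (hv : IsA1 K v) (hK : K ≠ ∞)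
    (D : Finset (Cube d)) (F : ι → (Fin d → ℝ) → Ω → ℝ≥0∞)
    (hF : ∀ j, Measurable (Function.uncurry (F j))) (x : Fin d → ℝ) (ω : Ω) :
    tOp r D F x ω ≤ (∏ j, (K ^ |e j| + 1)) * tOp rr D (fun j y ω => F j y ω * v y ^ e j) x ω := by
  refine iSup_le fun Q => iSup_le fun hQ => iSup_le fun hx => ?_
  set a := (∫⁻ y in bl Q, v y) / volume (bl Q) with ha
  have ha0 : a ≠ 0 := (ENNReal.div_pos (hv.int_ne_zero _ _ Q.side_pos) (vol_bl_ne_top Q)).ne'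
  have hat : a ≠ ∞ := ENNReal.div_ne_top (hv.int_ne_top hK _ _ Q.side_pos) (vol_bl_ne_zero Q)
  have h1 : ∀ j, av (r j) (fun y => F j y ω) Q ≤
      (K ^ |e j| + 1) * a ^ (-e j) * av (rr j) (fun y => F j y ω * v y ^ e j) Q := by
    intro j
    by_cases hji : j = i
    · subst hji
      have := av_le_main hv (r j) (rr j) (hr j) hri (measurable_section (hF j) ω) Q
      rw [← hei, ← ha] at this
      refine this.trans ?_
      gcongr
      calc a ^ (-e j) = 1 * a ^ (-e j) := (one_mul _).symm
        _ ≤ _ := by gcongr; exact le_add_self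
    · obtain ⟨h2, h3⟩ := hj j hji
      have := av_le_other hv hK (r j) (hr j) (e j) h3.le (measurable_section (hF j) ω) Q
      rw [h2, abs_of_pos h3]
      refine this.trans ?_
      rw [← ha]
      gcongr
      exact le_self_add
  calc ∏ j, av (r j) (fun y => F j y ω) Q
      ≤ ∏ j, ((K ^ |e j| + 1) * a ^ (-e j) * av (rr j) (fun y => F j y ω * v y ^ e j) Q) :=
        Finset.prod_le_prod' (fun j _ => h1 j)
    _ = (∏ j, (K ^ |e j| + 1)) * ∏ j, av (rr j) (fun y => F j y ω * v y ^ e j) Q := by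
        rw [Finset.prod_mul_distrib, Finset.prod_mul_distrib, prod_rpow_sum a ha0 hat,
          Finset.sum_neg_distrib, hsum]
        simp
    _ ≤ _ := by
        gcongr
        exact le_trans (le_iSup (fun _ : x ∈ bl Q => ∏ j, av (rr j) (fun y => F j y ω * v y ^ e j) Q) hx)
          (le_iSup₂ (f := fun Q (_ : Q ∈ D) => ⨆ (_ : x ∈ bl Q),
            ∏ j, av (rr j) (fun y => F j y ω * v y ^ e j) Q) Q hQ)

lemma gen {d : ℕ} {ι : Type} [Fintype ι] [Nontrivial ι] (r : ι → ℝ) (hr : ∀ j, 0 < r j)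
    (p t : ι → ℝ≥0∞) (hp : ∀ j, ENNReal.ofReal (r j) < p j)
    (ht : ∀ j, ENNReal.ofReal (r j) < t j) (hts : ∑ j, (t j)⁻¹ = 1) (hps : ∑ j, (p j)⁻¹ ≠ 0) :
    ∃ C : ℝ≥0∞, C ≠ ∞ ∧ ∀ (Ω : Type) [MeasurableSpace Ω] (μ : Measure Ω) [SigmaFinite μ]
      (D : Finset (Cube d)) (F : ι → (Fin d → ℝ) → Ω → ℝ≥0∞),
      (∀ j, Measurable (Function.uncurry (F j))) →
      eNorm (∑ j, (p j)⁻¹)⁻¹ volume (fun x => eNorm 1 μ (tOp r D F x)) ≤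
        C * ∏ j, eNorm (p j) volume (fun x => eNorm (t j) μ (F j x)) := by
  classical
  have hp0 : ∀ j, p j ≠ 0 := fun j => (bot_lt_of_lt (hp j)).ne'
  have ht0 : ∀ j, t j ≠ 0 := fun j => (bot_lt_of_lt (ht j)).ne'
  obtain ⟨i, -, hi⟩ : ∃ i ∈ Finset.univ, (p i)⁻¹ ≠ 0 := Finset.exists_ne_zero_of_sum_ne_zero hps
  have hpi : p i ≠ ∞ := by simpa using hi
  set b : ι → ℝ := fun j => ((p j)⁻¹).toReal with hb
  have hbp : ∀ j, ENNReal.ofReal (b j) = (p j)⁻¹ := fun j =>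
    ENNReal.ofReal_toReal (by simpa using hp0 j)
  have hb0 : ∀ j, 0 ≤ b j := fun j => ENNReal.toReal_nonneg
  have hbi : 0 < b i := ENNReal.toReal_pos hi (by simpa using hp0 i)
  have hlt : ∀ (z : ℝ≥0∞) (j : ι), ENNReal.ofReal (r j) < z → (z⁻¹).toReal < 1 / r j := by
    intro z j h
    rw [← ENNReal.inv_lt_inv] at h
    rw [← ENNReal.ofReal_inv_of_pos (hr j)] at h
    have h2 := (ENNReal.toReal_lt_toReal (h.ne_top) (by simp)).2 h
    rwa [ENNReal.toReal_ofReal (by have := hr j; positivity), ← one_div (r j)] at h2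
  obtain ⟨rr, e, q, hq1, hrr0, hrri, hei, hej, hesum, hbe, hτ⟩ := params r b
    (fun j => ((t j)⁻¹).toReal) hr hb0 (fun j => hlt _ j (hp j)) (fun j => hlt _ j (ht j)) i hbi
  have hq0 : 0 < q := by linarith
  set pp : ι → ℝ≥0∞ := fun j => (ENNReal.ofReal (b j + e j / q))⁻¹ with hpp
  have hppi : ∀ j, (pp j)⁻¹ = ENNReal.ofReal (b j + e j / q) := fun j => inv_inv _
  have hppsum : ∑ j, (pp j)⁻¹ = ∑ j, (p j)⁻¹ := by
    simp only [hppi, ← hbp]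
    rw [← ENNReal.ofReal_sum_of_nonneg (fun j _ => (hbe j).1.le),
      ← ENNReal.ofReal_sum_of_nonneg (fun j _ => hb0 j), Finset.sum_add_distrib, ← Finset.sum_div,
      hesum]
    simp
  have hrrp : ∀ j, ENNReal.ofReal (rr j) < pp j := by
    intro j
    rw [← ENNReal.inv_lt_inv, hppi, ← ENNReal.ofReal_inv_of_pos (hrr0 j), ← one_div (rr j)]
    exact (ENNReal.ofReal_lt_ofReal_iff (by have := hrr0 j; positivity)).2 (hbe j).2
  have hrrt : ∀ j, ENNReal.ofReal (rr j) < t j := by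
    intro j
    rw [← ENNReal.inv_lt_inv, ← ENNReal.ofReal_inv_of_pos (hrr0 j), ← one_div (rr j),
      ← ENNReal.ofReal_toReal (a := (t j)⁻¹) (by simpa using ht0 j)]
    exact (ENNReal.ofReal_lt_ofReal_iff (by have := hrr0 j; positivity)).2 (hτ j)
  have hppt : ∀ j, pp j ≠ ∞ := by
    intro j
    have := (hbe j).1
    simp [hpp, this]
  obtain ⟨C0, hC0, hcore⟩ := core (d := d) rr hrr0 pp t hrrp hppt hrrt hts (by rw [hppsum]; exact hps)
  obtain ⟨K, Cr, hK, hCr, hrub⟩ := rubio (d := d) q hq1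
  set K' := ∏ j, (K ^ |e j| + 1) with hK'
  have hK't : K' ≠ ∞ := ENNReal.prod_ne_top (fun j _ => by
    have : K ^ |e j| ≠ ∞ := ENNReal.rpow_ne_top_of_nonneg (abs_nonneg _) hK
    finiteness)
  have hCrb : Cr ^ b i ≠ ∞ := ENNReal.rpow_ne_top_of_nonneg hbi.le hCr
  set Cf := K' * C0 * ∏ _j : ι, (Cr ^ b i + 1) with hCf
  have hCft : Cf ≠ ∞ := ENNReal.mul_ne_top (ENNReal.mul_ne_top hK't hC0)
    (ENNReal.prod_ne_top (fun j _ => by finiteness))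
  have hsumt : ∑ j, (p j)⁻¹ ≠ ∞ := by
    rw [ENNReal.sum_ne_top]; intro j _; simpa using hp0 j
  have hρ0 : (∑ j, (p j)⁻¹)⁻¹ ≠ 0 := by simpa using hsumt
  refine ⟨Cf + 1, by finiteness, ?_⟩
  intro Ω _ μ _ D F hF
  have hTm := measurable_tOp r D hF
  set n : ι → ℝ≥0∞ := fun j => eNorm (p j) volume (fun x => eNorm (t j) μ (F j x)) with hn
  by_cases hz : ∃ j, n j = 0
  · obtain ⟨j, hj⟩ := hz
    have h1 := mixed_zero μ (p j) (t j) (hp0 j) (ht0 j) (hF j) hj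
    have h2 : eNorm (∑ j, (p j)⁻¹)⁻¹ volume (fun x => eNorm 1 μ (tOp r D F x)) = 0 := by
      rw [eNorm_eq_zero _ hρ0 _ (measurable_eNorm μ 1 hTm)]
      refine Filter.Eventually.of_forall fun x => ?_
      rw [eNorm_eq_zero _ one_ne_zero _ (measurable_section' hTm x)]
      filter_upwards [h1] with ω hω
      exact tOp_eq_zero r hr D F ω j hω x
    rw [h2]; exact zero_le
  push Not at hz
  by_cases hit : n i = ∞
  · have : ∏ j, n j = ∞ := by
      rw [← Finset.mul_prod_erase _ _ (Finset.mem_univ i), hit, ENNReal.top_mul]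
      exact Finset.prod_ne_zero_iff.2 (fun j _ => hz j)
    rw [this, ENNReal.mul_top (by simp)]
    exact le_top
  set h : (Fin d → ℝ) → ℝ≥0∞ := fun x => eNorm (t i) μ (F i x) with hh
  have hhm : Measurable h := measurable_eNorm μ (t i) (hF i)
  have hP : (p i).toReal = 1 / b i := by
    simp only [hb, ENNReal.toReal_inv]; rw [one_div, inv_inv]
  have hni : n i = (∫⁻ x, h x ^ (1 / b i)) ^ b i := by
    simp only [hn]
    rw [eNorm, if_neg hpi, hP, one_div_one_div]
  have hI0 : ∫⁻ x, h x ^ (1 / b i) ≠ 0 := by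
    intro h0; apply hz i; rw [hni, h0, ENNReal.zero_rpow_of_pos hbi]
  have hIt : ∫⁻ x, h x ^ (1 / b i) ≠ ∞ := by
    intro h0; apply hit; rw [hni, h0, ENNReal.top_rpow_of_pos hbi]
  have hpw : ∀ x, (h x ^ (1 / (b i * q))) ^ q = h x ^ (1 / b i) := by
    intro x
    rw [← ENNReal.rpow_mul]; congr 1; field_simp
  obtain ⟨v, hv, hle, hVle⟩ := hrub (fun x => h x ^ (1 / (b i * q))) (hhm.pow_const _)
    (by simpa only [hpw] using hI0) (by simpa only [hpw] using hIt)
  simp only [hpw] at hVle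
  set V := ∫⁻ x, v x ^ q with hV
  have hVt : V ≠ ∞ := ne_top_of_le_ne_top (ENNReal.mul_ne_top hCr hIt) hVle
  have hV0 : V ≠ 0 := by
    intro h0
    apply hI0
    rw [← nonpos_iff_eq_zero, ← h0, hV]
    apply lintegral_mono
    intro x
    show h x ^ (1 / b i) ≤ v x ^ q
    rw [← hpw]
    exact ENNReal.rpow_le_rpow (hle x) hq0.le
  have hle2 : ∀ x, h x ≤ v x ^ (q * b i) := by
    intro x
    have := ENNReal.rpow_le_rpow (hle x) (by positivity : 0 ≤ q * b i)
    rwa [← ENNReal.rpow_mul, mul_comm q, one_div_mul_cancel (by positivity), ENNReal.rpow_one,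
      mul_comm (b i)] at this
  set FF : ι → (Fin d → ℝ) → Ω → ℝ≥0∞ := fun j y ω => F j y ω * v y ^ e j with hFF
  have hFFm : ∀ j, Measurable (Function.uncurry (FF j)) := fun j =>
    (hF j).mul ((hv.1.comp measurable_fst).pow_const _)
  have hTFm := measurable_tOp rr D hFFm
  have hnorm : ∀ j, eNorm (pp j) volume (fun x => eNorm (t j) μ (FF j x)) ≤
      (Cr ^ b i + 1) * n j * V ^ (e j / q) := by
    intro j
    have h1 : ∀ x, eNorm (t j) μ (FF j x) = eNorm (t j) μ (F j x) * v x ^ e j := by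
      intro x
      rw [mul_comm, ← eNorm_const_mul (t j) (ht0 j) μ _ (measurable_section' (hF j) x)]
      congr 1; ext ω; simp only [hFF]; rw [mul_comm]
    simp only [h1]
    by_cases hji : j = i
    · subst hji
      refine (norm_main hv.2.1 hv.2.2.1 q (b j) (e j) hq0 (hbe j).1 hle2).trans ?_
      rw [← hV, ENNReal.rpow_add _ _ hV0 hVt, hni]
      gcongr
      calc V ^ b j ≤ (Cr * ∫⁻ x, h x ^ (1 / b j)) ^ b j := by gcongr
        _ = Cr ^ b j * (∫⁻ x, h x ^ (1 / b j)) ^ b j := ENNReal.mul_rpow_of_nonneg _ _ hbi.le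
        _ ≤ _ := by gcongr; exact le_self_add
    · have he := (hej j hji).2
      refine (norm_other hv.1 (measurable_eNorm μ (t j) (hF j)) q (e j) hq0 he (p j) (pp j) (hp0 j)
        (by rw [hppi, ENNReal.ofReal_add (hb0 j) (by positivity), hbp])).trans ?_
      rw [← hV]
      gcongr
      calc n j = 1 * n j := (one_mul _).symm
        _ ≤ _ := by gcongr; exact le_add_self
  calc eNorm (∑ j, (p j)⁻¹)⁻¹ volume (fun x => eNorm 1 μ (tOp r D F x))
      ≤ eNorm (∑ j, (p j)⁻¹)⁻¹ volume (fun x => K' * eNorm 1 μ (tOp rr D FF x)) := by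
        apply eNorm_mono; intro x
        rw [← eNorm_const_mul 1 one_ne_zero μ K' (measurable_section' hTFm x)]
        apply eNorm_mono; intro ω
        exact tOp_weight r rr e hr i hrri hei hej hesum hv hK D F hF x ω
    _ = K' * eNorm (∑ j, (pp j)⁻¹)⁻¹ volume (fun x => eNorm 1 μ (tOp rr D FF x)) := by
        rw [eNorm_const_mul _ hρ0 _ _ (measurable_eNorm μ 1 hTFm), hppsum]
    _ ≤ K' * (C0 * ∏ j, eNorm (pp j) volume (fun x => eNorm (t j) μ (FF j x))) := by
        gcongr
        exact hcore Ω μ D FF hFFm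
    _ ≤ K' * (C0 * ∏ j, ((Cr ^ b i + 1) * n j * V ^ (e j / q))) := by
        gcongr with j
        exact hnorm j
    _ = Cf * ∏ j, n j := by
        rw [Finset.prod_mul_distrib, Finset.prod_mul_distrib, prod_rpow_sum V hV0 hVt,
          ← Finset.sum_div, hesum, zero_div, ENNReal.rpow_zero, hCf]
        ring
    _ ≤ _ := by gcongr; exact le_self_add


lemma cube_subset_bl {d : ℕ} (Q : Cube d) : Q.set ⊆ bl Q := by
  intro x hx
  have hs := Q.side_pos
  rw [bl, Metric.mem_ball, dist_pi_lt_iff hs]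
  intro i
  have := hx i
  rw [Real.dist_eq, abs_lt]
  constructor <;> linarith [this.1, this.2]

lemma vol_bl {d : ℕ} (Q : Cube d) : volume (bl Q) = 2 ^ d * Q.vol := by
  have h1 : Q.set = Set.pi Set.univ (fun i => Set.Ico (Q.corner i) (Q.corner i + Q.side)) := by
    ext x; simp [Cube.set, Set.mem_pi]
  have hs := Q.side_pos
  rw [bl, Real.volume_pi_ball _ hs, Cube.vol, h1, Real.volume_pi_Ico]
  simp only [add_sub_cancel_left, Finset.prod_const, Finset.card_univ, Fintype.card_fin]
  rw [show (2:ℝ≥0∞) = ENNReal.ofReal 2 by simp, ← mul_pow, ← ENNReal.ofReal_mul (by norm_num),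
    ENNReal.ofReal_pow (by positivity)]

lemma latAvg_le {d : ℕ} {Ω : Type} (r : ℝ≥0∞) (f : (Fin d → ℝ) → Ω → ℂ) (Q : Cube d) (ω : Ω) :
    latAvg r f Q ω ≤ ((2:ℝ≥0∞) ^ d) ^ (1 / r.toReal) *
      av r.toReal (fun y => nn (f y) ω) Q := by
  unfold latAvg av
  rw [← ENNReal.mul_rpow_of_nonneg _ _ (by positivity)]
  apply ENNReal.rpow_le_rpow _ (by positivity)
  have h2 : (2:ℝ≥0∞) ^ d ≠ 0 := by simp
  have h2t : (2:ℝ≥0∞) ^ d ≠ ∞ := by finiteness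
  calc (∫⁻ y in Q.set, (‖f y ω‖₊ : ℝ≥0∞) ^ r.toReal) / Q.vol
      ≤ (∫⁻ y in bl Q, (‖f y ω‖₊ : ℝ≥0∞) ^ r.toReal) / Q.vol := by
        refine ENNReal.div_le_div_right ?_ _
        exact lintegral_mono_set (cube_subset_bl Q)
    _ = 2 ^ d * ((∫⁻ y in bl Q, nn (f y) ω ^ r.toReal) / volume (bl Q)) := by
        rw [vol_bl, ← mul_div_assoc, ENNReal.mul_div_mul_left _ _ h2 h2t]
        rfl

lemma mul_prod_option {m : ℕ} (a b : Option (Fin m) → ℝ≥0∞) :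
    (∏ j, a (some j) * b (some j)) * (a none * b none) = (∏ j, a j) * ∏ j, b j := by
  rw [Fintype.prod_option, Fintype.prod_option, Finset.prod_mul_distrib]
  ring

/-- boundedness of the lattice multisublinear maximal operator
`M̃_{(r⃗,s')}` from `∏ L^{p_j}(L^{t_j}) × L^{p_{m+1}}(L^{t'})` to `L^ρ(L^1)`. -/
theorem statement12 (d m : ℕ) (hd : 1 ≤ d) (hm : 1 ≤ m)
    (r : Fin m → ℝ≥0∞) (hr : ∀ j, 0 < r j ∧ r j ≠ ∞)
    (s : ℝ≥0∞) (hs : 1 < s)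
    (t : Fin m → ℝ≥0∞) (hrt : ∀ j, r j < t j)
    (ht1 : 1 ≤ (∑ j, (t j)⁻¹)⁻¹) (hts : (∑ j, (t j)⁻¹)⁻¹ < s)
    (p : Fin m → ℝ≥0∞) (hrp : ∀ j, r j < p j)
    (pm : ℝ≥0∞) (hpm : (1 - s⁻¹)⁻¹ < pm)
    (hrho : ((∑ j, (p j)⁻¹) + pm⁻¹)⁻¹ ≠ ∞) :
    ∃ C : ℝ≥0∞, 0 < C ∧ C ≠ ∞ ∧
      ∀ (Ω : Type) [MeasurableSpace Ω] (μ : Measure Ω) [SigmaFinite μ],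
      ∀ (D : Finset (Cube d)) (f : Fin m → (Fin d → ℝ) → Ω → ℂ)
        (g : (Fin d → ℝ) → Ω → ℂ),
        (∀ j, Measurable (Function.uncurry (f j))) →
        Measurable (Function.uncurry g) →
        eNorm ((∑ j, (p j)⁻¹) + pm⁻¹)⁻¹ volume
            (fun x => eNorm 1 μ (latMaxX r (1 - s⁻¹)⁻¹ D f g x)) ≤
          C * (∏ j, eNorm (p j) volume (fun x => eNorm (t j) μ (nn (f j x)))) *
            eNorm pm volume
              (fun x => eNorm (1 - (∑ j, (t j)⁻¹))⁻¹ μ (nn (g x))) := by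


  haveI : Nonempty (Fin m) := ⟨⟨0, hm⟩⟩
  have hs1 : s⁻¹ < 1 := ENNReal.inv_lt_one.2 hs
  have hu0 : 1 - s⁻¹ ≠ 0 := (tsub_pos_of_lt hs1).ne'
  have hut : 1 - s⁻¹ ≠ ∞ := by finiteness
  set s' := (1 - s⁻¹)⁻¹ with hs'
  have hs'0 : s' ≠ 0 := by simpa [hs'] using hut
  have hs't : s' ≠ ∞ := by simpa [hs'] using hu0
  set T := ∑ j, (t j)⁻¹ with hT
  have hT1 : T ≤ 1 := by rw [← ENNReal.one_le_inv]; exact ht1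
  have hTs : s⁻¹ < T := by
    rw [← inv_inv T]; exact ENNReal.inv_lt_inv.2 hts
  have hst : s' < (1 - T)⁻¹ := by
    rw [hs', ENNReal.inv_lt_inv]
    exact (ENNReal.cancel_of_ne (a := 1 - T) (by finiteness)).tsub_lt_tsub_left_of_le hT1 hTs
  let R : Option (Fin m) → ℝ≥0∞ := fun o => o.elim s' r
  let P : Option (Fin m) → ℝ≥0∞ := fun o => o.elim pm p
  let TT : Option (Fin m) → ℝ≥0∞ := fun o => o.elim (1 - T)⁻¹ t
  have hR0 : ∀ o, 0 < (R o).toReal := by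
    intro o; cases o with
    | none => exact ENNReal.toReal_pos hs'0 hs't
    | some j => exact ENNReal.toReal_pos (hr j).1.ne' (hr j).2
  have hRo : ∀ o, ENNReal.ofReal (R o).toReal = R o := by
    intro o; apply ENNReal.ofReal_toReal
    cases o with
    | none => exact hs't
    | some j => exact (hr j).2
  have hPs : ∑ o, (P o)⁻¹ = (∑ j, (p j)⁻¹) + pm⁻¹ := by
    rw [Fintype.sum_option, add_comm]
    rfl
  have hTs : ∑ o, (TT o)⁻¹ = 1 := by
    rw [Fintype.sum_option]
    show ((1 - T)⁻¹)⁻¹ + T = 1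
    rw [inv_inv, tsub_add_cancel_of_le hT1]
  obtain ⟨C, hC, h⟩ := gen (d := d) (fun o => (R o).toReal) hR0 P TT
    (by intro o; rw [hRo]; cases o; exacts [hpm, hrp _])
    (by intro o; rw [hRo]; cases o; exacts [hst, hrt _])
    hTs (by rw [hPs]; intro h0; apply hrho; rw [h0]; simp)
  set A : Option (Fin m) → ℝ≥0∞ := fun o => ((2:ℝ≥0∞) ^ d) ^ (1 / (R o).toReal) with hA
  have hAt : ∏ o, A o ≠ ∞ := ENNReal.prod_ne_top (fun o _ =>
    ENNReal.rpow_ne_top_of_nonneg (by positivity) (by finiteness))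
  refine ⟨(∏ o, A o) * C + 1, by positivity, by finiteness, ?_⟩
  intro Ω _ μ _ D f g hf hg
  let F : Option (Fin m) → (Fin d → ℝ) → Ω → ℝ≥0∞ := fun o =>
    o.elim (fun y => nn (g y)) (fun j y => nn (f j y))
  have hFm : ∀ o, Measurable (Function.uncurry (F o)) := by
    intro o; cases o with
    | none => exact hg.nnnorm.coe_nnreal_ennreal
    | some j => exact (hf j).nnnorm.coe_nnreal_ennreal
  have hTm := measurable_tOp (fun o => (R o).toReal) D hFm
  have hmain := h Ω μ D F hFm
  rw [hPs, Fintype.prod_option] at hmain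
  have hpt : ∀ x ω, latMaxX r s' D f g x ω ≤
      (∏ o, A o) * tOp (fun o => (R o).toReal) D F x ω := by
    intro x ω
    refine iSup_le fun Q => iSup_le fun hQ => iSup_le fun hx => ?_
    have hx' := cube_subset_bl Q hx
    calc (∏ j, latAvg (r j) (f j) Q ω) * latAvg s' g Q ω
        ≤ (∏ j, A (some j) * av (R (some j)).toReal (fun y => F (some j) y ω) Q) *
          (A none * av (R none).toReal (fun y => F none y ω) Q) := by
          refine mul_le_mul' (Finset.prod_le_prod' fun j _ => ?_) ?_
          · exact latAvg_le (r j) (f j) Q ω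
          · exact latAvg_le s' g Q ω
      _ = (∏ o, A o) * ∏ o, av (R o).toReal (fun y => F o y ω) Q :=
          mul_prod_option A (fun o => av (R o).toReal (fun y => F o y ω) Q)
      _ ≤ _ := by
          gcongr
          exact le_trans
            (le_iSup (fun _ : x ∈ bl Q => ∏ o, av (R o).toReal (fun y => F o y ω) Q) hx')
            (le_iSup₂ (f := fun Q (_ : Q ∈ D) => ⨆ (_ : x ∈ bl Q),
              ∏ o, av (R o).toReal (fun y => F o y ω) Q) Q hQ)
  have hρ0 : ((∑ j, (p j)⁻¹) + pm⁻¹)⁻¹ ≠ 0 := by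
    have h1 : ∀ j, p j ≠ 0 := fun j => (bot_lt_of_lt (hrp j)).ne'
    have h2 : pm ≠ 0 := (bot_lt_of_lt hpm).ne'
    have h3 : ∑ j, (p j)⁻¹ ≠ ∞ := by
      rw [ENNReal.sum_ne_top]; intro j _; simpa using h1 j
    have h4 : pm⁻¹ ≠ ∞ := by simpa using h2
    exact ENNReal.inv_ne_zero.2 (ENNReal.add_ne_top.2 ⟨h3, h4⟩)
  calc eNorm ((∑ j, (p j)⁻¹) + pm⁻¹)⁻¹ volume (fun x => eNorm 1 μ (latMaxX r s' D f g x))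
      ≤ eNorm ((∑ j, (p j)⁻¹) + pm⁻¹)⁻¹ volume
          (fun x => (∏ o, A o) * eNorm 1 μ (tOp (fun o => (R o).toReal) D F x)) := by
        apply eNorm_mono; intro x
        rw [← eNorm_const_mul 1 one_ne_zero μ _ (measurable_section' hTm x)]
        exact eNorm_mono _ _ (hpt x)
    _ = (∏ o, A o) * eNorm ((∑ j, (p j)⁻¹) + pm⁻¹)⁻¹ volume
          (fun x => eNorm 1 μ (tOp (fun o => (R o).toReal) D F x)) :=
        eNorm_const_mul _ hρ0 _ _ (measurable_eNorm μ 1 hTm)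
    _ ≤ _ := mul_le_mul_right hmain _
    _ = ((∏ o, A o) * C) * ((∏ j, eNorm (p j) volume (fun x => eNorm (t j) μ (nn (f j x)))) *
          eNorm pm volume (fun x => eNorm (1 - T)⁻¹ μ (nn (g x)))) := by
        rw [mul_assoc]
        congr 2
        exact mul_comm _ _
    _ ≤ _ := by
        rw [mul_assoc (_ + 1)]
        gcongr
        exact le_self_add
end
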